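/- Let T be a feasible connected digraph of order k ≥ 1. Suppose the cutoffs satisfy n·rₙ² → λ for some λ ∈ (0,∞) as n → ∞. Then, almost surely, n⁻¹·H̃_{n,T} → k⁻¹ ∫_{ℝ²} φ_T(λ f(x)) f(x) dx as n → ∞. -/

import Mathlib

open MeasureTheory ProbabilityTheory Filter Real Set
open scoped Topology

noncomputable section

/-- The circular sector with apex `x`, radius `r`, central angle `a` and
inclination `y` (measured anticlockwise from the horizontal direction). -/
def sector (a : ℝ) (x : ℂ) (y r : ℝ) : Set ℂ :=
  {z : ℂ | ‖z - x‖ ≤ r ∧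
    ∃ t : ℝ, y ≤ t ∧ t ≤ y + a ∧
      z - x = (‖z - x‖ : ℂ) * Complex.exp (t * Complex.I)}

/-- Arc relation of the sector digraph on the configuration `x` (points) and `y`
(inclinations) with cutoff `r`: there is an arc from `i` to `j` iff `i ≠ j` and
the point `x j` lies in the sector of `i`. -/
def arc (a r : ℝ) {n : ℕ} (x : Fin n → ℂ) (y : Fin n → ℝ) (i j : Fin n) : Prop :=
  i ≠ j ∧ x j ∈ sector a (x i) (y i) r

/-- The sector digraph (cutoff `r`) on the `k`-point configuration `(x, y)` is
isomorphic to the digraph `T` on `Fin k`. -/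
def isoT (a r : ℝ) {k : ℕ} (T : Fin k → Fin k → Prop) (x : Fin k → ℂ) (y : Fin k → ℝ) : Prop :=
  ∃ e : Equiv.Perm (Fin k), ∀ i j, T i j ↔ arc a r x y (e i) (e j)

/-- The number of isolated induced subdigraphs of the sector digraph on the
configuration `(x, y)` with cutoff `r` that are isomorphic to `T`: `k`-element
vertex subsets inducing a digraph isomorphic to `T` with no arc leaving the subset. -/
def isolatedCount (a r : ℝ) {k : ℕ} (T : Fin k → Fin k → Prop) {n : ℕ}
    (x : Fin n → ℂ) (y : Fin n → ℝ) : ℕ :=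
  Set.ncard {s : Finset (Fin n) |
    (∃ g : Fin k ↪ Fin n, Finset.univ.map g = s ∧
      ∀ i j, T i j ↔ arc a r x y (g i) (g j)) ∧
    ∀ i ∈ s, ∀ j, j ∉ s → ¬ arc a r x y i j}

open Classical in
/-- The indicator function `h_T` : equal to `1` if the sector digraph with radius `1`
on the configuration `(x, y)` is isomorphic to `T`, and `0` otherwise. -/
def hInd (a : ℝ) {k : ℕ} (T : Fin k → Fin k → Prop) (x : Fin k → ℂ) (y : Fin k → ℝ) : ℝ :=
  if isoT a 1 T x y then 1 else 0

/-- The `k`-point configuration `(0, z 1, …, z (k-1))`. -/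
def pts {k : ℕ} (z : Fin (k - 1) → ℂ) (i : Fin k) : ℂ :=
  if h : (i : ℕ) = 0 then 0 else z ⟨(i : ℕ) - 1, by have := i.isLt; omega⟩

/-- The Lebesgue measure of `S(x₁,…,x_k,y₁,…,y_k) = ∪_{i=1}^k S(xᵢ,yᵢ,1)`. -/
def sectorUnionVol (a : ℝ) {k : ℕ} (x : Fin k → ℂ) (y : Fin k → ℝ) : ℝ :=
  (volume (⋃ i, sector a (x i) (y i) 1)).toReal

/-- The function `φ_T`. -/
def phiT (a : ℝ) (k : ℕ) (T : Fin k → Fin k → Prop) (t : ℝ) : ℝ :=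
  if k = 1 then Real.exp (-(t * a) / 2)
  else (t ^ (k - 1) / ((k - 1).factorial * (2 * π) ^ k)) *
    ∫ y in Set.univ.pi (fun _ : Fin k => Set.Ico 0 (2 * π)),
      ∫ z : Fin (k - 1) → ℂ,
        hInd a T (pts z) y * Real.exp (-t * sectorUnionVol a (pts z) y)

/-- Union of the sectors of a configuration. -/
def SecU (a r : ℝ) {k : ℕ} (v : Fin k → ℂ × ℝ) : Set ℂ :=
  ⋃ i, sector a (v i).1 (v i).2 r

/-- `isoT` for a joint configuration. -/
def Iso (a r : ℝ) {k : ℕ} (T : Fin k → Fin k → Prop) (v : Fin k → ℂ × ℝ) : Prop :=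
  isoT a r T (fun i => (v i).1) (fun i => (v i).2)

/-- The embedding `g` picks an isolated copy of `T`. -/
def Good (a r : ℝ) {k n : ℕ} (T : Fin k → Fin k → Prop) (g : Fin k ↪ Fin n)
    (w : Fin n → ℂ × ℝ) : Prop :=
  Iso a r T (fun i => w (g i)) ∧ ∀ j, j ∉ Set.range g → (w j).1 ∉ SecU a r (fun i => w (g i))

lemma isClosed_sector_rel (a r : ℝ) :
    IsClosed {p : ℂ × ℂ × ℝ | p.1 ∈ sector a p.2.1 p.2.2 r} := by
  have hC : IsClosed {q : (Set.Icc (0 : ℝ) a) × (ℂ × ℂ × ℝ) | ‖q.2.1 - q.2.2.1‖ ≤ r ∧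
      q.2.1 - q.2.2.1 = (‖q.2.1 - q.2.2.1‖ : ℂ) *
        Complex.exp (((q.2.2.2 + (q.1 : ℝ) : ℝ) : ℂ) * Complex.I)} := by
    refine IsClosed.and (isClosed_le ?_ ?_) (isClosed_eq ?_ ?_) <;> fun_prop
  have := isClosedMap_snd_of_compactSpace _ hC
  convert this using 1
  ext p
  simp only [sector, Set.mem_ofPred_eq, Set.mem_image, Prod.exists, Subtype.exists]
  constructor
  · rintro ⟨h1, t, h2, h3, h4⟩
    refine ⟨t - p.2.2, ⟨by linarith, by linarith⟩, p.1, p.2.1, p.2.2, ⟨h1, ?_⟩, rfl⟩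
    simpa using h4
  · rintro ⟨s, hs, z, x, y, ⟨h1, h2⟩, rfl⟩
    exact ⟨h1, y + s, by linarith [hs.1], by linarith [hs.2], h2⟩

lemma measurableSet_sector_rel (a r : ℝ) :
    MeasurableSet {p : ℂ × ℂ × ℝ | p.1 ∈ sector a p.2.1 p.2.2 r} :=
  (isClosed_sector_rel a r).measurableSet

lemma measurableSet_sector (a r : ℝ) (x : ℂ) (y : ℝ) : MeasurableSet (sector a x y r) := by
  have := measurableSet_sector_rel a r
  have h : Measurable (fun z : ℂ => (z, x, y)) := by fun_prop
  exact h this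

lemma measurableSet_SecU (a r : ℝ) {k : ℕ} (v : Fin k → ℂ × ℝ) : MeasurableSet (SecU a r v) :=
  MeasurableSet.iUnion fun _ => measurableSet_sector _ _ _ _

lemma measurableSet_SecU_rel (a r : ℝ) {k : ℕ} :
    MeasurableSet {p : (Fin k → ℂ × ℝ) × ℂ | p.2 ∈ SecU a r p.1} := by
  simp only [SecU, Set.mem_iUnion]
  rw [Set.ofPred_exists]
  refine MeasurableSet.iUnion fun i => ?_
  have h : Measurable (fun p : (Fin k → ℂ × ℝ) × ℂ => (p.2, (p.1 i).1, (p.1 i).2)) := by fun_prop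
  exact h (measurableSet_sector_rel a r)

lemma measurableSet_Iso (a r : ℝ) {k : ℕ} (T : Fin k → Fin k → Prop) :
    MeasurableSet {v : Fin k → ℂ × ℝ | Iso a r T v} := by
  unfold Iso isoT arc
  rw [Set.ofPred_exists]
  refine MeasurableSet.iUnion fun e => ?_
  rw [Set.ofPred_forall]
  refine MeasurableSet.iInter fun i => ?_
  rw [Set.ofPred_forall]
  refine MeasurableSet.iInter fun j => ?_
  refine MeasurableSet.iff (MeasurableSet.const _) (MeasurableSet.inter (MeasurableSet.const _) ?_)
  have h : Measurable (fun p : (Fin k → ℂ × ℝ) => ((p (e j)).1, (p (e i)).1, (p (e i)).2)) := by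
    fun_prop
  exact h (measurableSet_sector_rel a r)

lemma measurableSet_Good (a r : ℝ) {k n : ℕ} (T : Fin k → Fin k → Prop) (g : Fin k ↪ Fin n) :
    MeasurableSet {w : Fin n → ℂ × ℝ | Good a r T g w} := by
  unfold Good
  refine MeasurableSet.inter ?_ ?_
  · have h : Measurable (fun w : Fin n → ℂ × ℝ => fun i => w (g i)) := by fun_prop
    exact h (measurableSet_Iso a r T)
  · change MeasurableSet {w : Fin n → ℂ × ℝ | ∀ j, j ∉ Set.range g →
      (w j).1 ∉ SecU a r (fun i => w (g i))}
    rw [Set.ofPred_forall]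
    refine MeasurableSet.iInter fun j => ?_
    rw [Set.ofPred_forall]
    refine MeasurableSet.iInter fun hj => ?_
    have h : Measurable (fun w : Fin n → ℂ × ℝ => ((fun i => w (g i)), (w j).1)) := by fun_prop
    exact h (measurableSet_SecU_rel a r).compl

lemma sector_scale (a : ℝ) {r : ℝ} (hr : 0 < r) (x x' z : ℂ) (y : ℝ) :
    x + r * z ∈ sector a (x + r * x') y r ↔ z ∈ sector a x' y 1 := by
  have e : x + r * z - (x + r * x') = r * (z - x') := by ring
  have hn : ‖(r : ℂ) * (z - x')‖ = r * ‖z - x'‖ := by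
    rw [norm_mul, Complex.norm_real, Real.norm_of_nonneg hr.le]
  have hr' : (r : ℂ) ≠ 0 := by exact_mod_cast hr.ne'
  simp only [sector, Set.mem_ofPred_eq, e, hn]
  refine and_congr ?_ ?_
  · exact mul_le_iff_le_one_right hr
  · refine exists_congr fun t => and_congr Iff.rfl (and_congr Iff.rfl ?_)
    push_cast
    rw [mul_assoc, mul_right_inj' hr']

lemma Iso_scale (a : ℝ) {r : ℝ} (hr : 0 < r) {k : ℕ} (T : Fin k → Fin k → Prop) (x : ℂ)
    (v : Fin k → ℂ × ℝ) :
    Iso a r T (fun i => (x + r * (v i).1, (v i).2)) ↔ Iso a 1 T v := by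
  simp only [Iso, isoT, arc, sector_scale a hr]

lemma SecU_scale (a : ℝ) {r : ℝ} (hr : 0 < r) {k : ℕ} (x z : ℂ)
    (v : Fin k → ℂ × ℝ) :
    x + r * z ∈ SecU a r (fun i => (x + r * (v i).1, (v i).2)) ↔ z ∈ SecU a 1 v := by
  simp only [SecU, Set.mem_iUnion, sector_scale a hr]

lemma walk_bound {k : ℕ} (G : SimpleGraph (Fin k)) (x : Fin k → ℂ) (r : ℝ)
    (h : ∀ i j, G.Adj i j → ‖x i - x j‖ ≤ r) {i j : Fin k} (p : G.Walk i j) :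
    ‖x i - x j‖ ≤ p.length * r := by
  induction p with
  | nil => simp
  | @cons u v w hadj p ih =>
    have := h _ _ hadj
    have h3 : ‖x u - x w‖ ≤ ‖x u - x v‖ + ‖x v - x w‖ := by
      have := norm_add_le (x u - x v) (x v - x w)
      simpa using this
    rw [SimpleGraph.Walk.length_cons]; push_cast; linarith

lemma Iso_bound {a r : ℝ} (hr : 0 ≤ r) {k : ℕ} {T : Fin k → Fin k → Prop}
    (hT : (SimpleGraph.fromRel T).Connected) {v : Fin k → ℂ × ℝ} (h : Iso a r T v) (i j : Fin k) :
    ‖(v i).1 - (v j).1‖ ≤ k * r := by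
  obtain ⟨e, he⟩ := h
  have hadj : ∀ i j, (SimpleGraph.fromRel T).Adj i j →
      ‖(v (e i)).1 - (v (e j)).1‖ ≤ r := by
    intro i j hij
    rw [SimpleGraph.fromRel_adj] at hij
    rcases hij.2 with h | h
    · rw [norm_sub_rev]; exact ((he _ _).1 h).2.1
    · exact ((he _ _).1 h).2.1
  obtain ⟨p, hp⟩ := hT.exists_isPath (e.symm i) (e.symm j)
  have h1 := walk_bound _ (fun i => (v (e i)).1) r hadj p
  have h2 := hp.length_lt
  simp only [Equiv.apply_symm_apply] at h1
  refine h1.trans (mul_le_mul_of_nonneg_right ?_ hr)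
  simp at h2
  exact_mod_cast h2.le

lemma SecU_bound {a r : ℝ} {k : ℕ} {v : Fin k → ℂ × ℝ} {z : ℂ} (hz : z ∈ SecU a r v) :
    ∃ i, ‖z - (v i).1‖ ≤ r := by
  obtain ⟨i, hi⟩ := Set.mem_iUnion.1 hz
  exact ⟨i, hi.1⟩

lemma mem_sector_self {a r : ℝ} (ha : 0 ≤ a) (hr : 0 ≤ r) (x : ℂ) (y : ℝ) : x ∈ sector a x y r :=
  ⟨by simpa using hr, y, le_rfl, by linarith, by simp⟩

open Classical in
lemma count_eq (a r : ℝ) {k n : ℕ} (T : Fin k → Fin k → Prop) (w : Fin n → ℂ × ℝ) :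
    isolatedCount a r T (fun i => (w i).1) (fun i => (w i).2) * k.factorial =
      (Finset.univ.filter (fun g : Fin k ↪ Fin n => Good a r T g w)).card := by
  have harc : ∀ (g : Fin k ↪ Fin n) (i j), arc a r (fun i => (w i).1) (fun i => (w i).2) (g i) (g j)
      ↔ arc a r (fun i => (w (g i)).1) (fun i => (w (g i)).2) i j := by
    intro g i j; simp [arc]
  set S : Set (Finset (Fin n)) := {s : Finset (Fin n) |
    (∃ g : Fin k ↪ Fin n, Finset.univ.map g = s ∧
      ∀ i j, T i j ↔ arc a r (fun i => (w i).1) (fun i => (w i).2) (g i) (g j)) ∧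
    ∀ i ∈ s, ∀ j, j ∉ s → ¬ arc a r (fun i => (w i).1) (fun i => (w i).2) i j} with hS
  have hgood : ∀ g : Fin k ↪ Fin n, Good a r T g w ↔ Finset.univ.map g ∈ S := by
    intro g
    simp only [hS, Set.mem_ofPred_eq, Good, Iso, isoT]
    refine and_congr ?_ ?_
    · constructor
      · rintro ⟨e, he⟩
        refine ⟨e.toEmbedding.trans g, ?_, ?_⟩
        · rw [← Finset.map_map]; simp
        · intro i j; rw [he]; simp [arc]
      · rintro ⟨g', hg', h⟩
        have hm : ∀ i, ∃ j, g j = g' i := by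
          intro i
          have : g' i ∈ Finset.univ.map g' := by simp
          rw [hg'] at this
          simpa using this
        choose e he using hm
        have hinj : Function.Injective e := by
          intro i j hij
          apply g'.injective
          rw [← he, ← he, hij]
        refine ⟨Equiv.ofBijective e (Finite.injective_iff_bijective.1 hinj), ?_⟩
        intro i j
        rw [h, ← he, ← he, harc]; rfl
    · constructor
      · intro h i hi j hj harc
        obtain ⟨i', -, rfl⟩ := Finset.mem_map.1 hi
        refine h j ?_ (Set.mem_iUnion.2 ⟨i', harc.2⟩)
        rintro ⟨j', rfl⟩; simp at hj
      · intro h j hj hmem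
        obtain ⟨i, hi⟩ := Set.mem_iUnion.1 hmem
        refine h (g i) (by simp) j ?_ ⟨?_, hi⟩
        · simpa using hj
        · rintro rfl; exact hj ⟨i, rfl⟩
  have hcard : isolatedCount a r T (fun i => (w i).1) (fun i => (w i).2) = S.toFinset.card := by
    rw [← Set.ncard_eq_toFinset_card']; rfl
  rw [hcard, mul_comm]
  symm
  rw [Finset.card_eq_sum_card_fiberwise (f := fun g : Fin k ↪ Fin n => Finset.univ.map g)
    (t := S.toFinset)]
  · rw [Finset.sum_const_nat (m := k.factorial)]
    · ring
    intro s hs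
    rw [Set.mem_toFinset] at hs
    obtain ⟨g₀, hg₀, -⟩ := hs.1
    have : (Finset.univ.filter (fun g : Fin k ↪ Fin n => Good a r T g w)).filter
        (fun g => Finset.univ.map g = s) =
        Finset.univ.image (fun e : Equiv.Perm (Fin k) => e.toEmbedding.trans g₀) := by
      ext g
      simp only [Finset.mem_filter, Finset.mem_univ, true_and, Finset.mem_image]
      constructor
      · rintro ⟨-, hg'⟩
        have hm : ∀ i, ∃ j, g₀ j = g i := by
          intro i
          have : g i ∈ Finset.univ.map g := by simp
          rw [hg', ← hg₀] at this
          simpa using this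
        choose e he using hm
        have hinj : Function.Injective e := by
          intro i j hij
          apply g.injective
          rw [← he, ← he, hij]
        refine ⟨Equiv.ofBijective e (Finite.injective_iff_bijective.1 hinj), ?_⟩
        ext i
        simp [he]
      · rintro ⟨e, rfl⟩
        have : Finset.univ.map (e.toEmbedding.trans g₀) = s := by
          rw [← Finset.map_map]; simpa using hg₀
        refine ⟨?_, this⟩
        rw [hgood, this]; exact hs
    rw [this, Finset.card_image_of_injective, Finset.card_univ, Fintype.card_perm, Fintype.card_fin]
    intro e e' h
    ext i
    have := DFunLike.congr_fun h i
    simpa [Fin.ext_iff] using this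
  · intro g hg
    simp only [Finset.coe_filter, Finset.mem_univ, true_and, Set.mem_ofPred_eq] at hg
    simpa using (hgood g).1 hg

lemma piFinSucc_symm {E : Type} [MeasurableSpace E] {n : ℕ} (p : E × (Fin n → E)) :
    (MeasurableEquiv.piFinSuccAbove (fun _ : Fin (n + 1) => E) 0).symm p =
      (Fin.cons p.1 p.2 : Fin (n + 1) → E) := by
  rw [← Fin.insertNth_zero']; rfl

lemma mcd_aux {E : Type} [MeasurableSpace E] (μ : Measure E) [IsProbabilityMeasure μ] (c : ℝ) :
    ∀ (n : ℕ) (F : (Fin n → E) → ℝ), Measurable F → (∃ B, ∀ w, |F w| ≤ B) →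
    (∀ w i e, |F (Function.update w i e) - F w| ≤ c) → ∀ t : ℝ,
    ∫ w, Real.exp (t * (F w - ∫ w', F w' ∂(Measure.pi fun _ : Fin n => μ)))
      ∂(Measure.pi fun _ : Fin n => μ) ≤ Real.exp (n * c ^ 2 * t ^ 2 / 2) := by
  intro n
  induction n with
  | zero =>
    intro F hF _ _ t
    have hconst : F = fun _ => F default := by
      ext w; rw [Subsingleton.elim w default]
    rw [hconst]
    simp
  | succ n ih =>
    intro F hF hB hd t
    obtain ⟨B, hB⟩ := hB
    set P := Measure.pi fun _ : Fin n => μ with hP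
    have hmp := measurePreserving_piFinSuccAbove (fun _ : Fin (n + 1) => μ) 0
    have key : ∀ f : (Fin (n + 1) → E) → ℝ,
        ∫ w, f w ∂(Measure.pi fun _ : Fin (n + 1) => μ) =
        ∫ p, f (Fin.cons p.1 p.2) ∂(μ.prod P) := by
      intro f
      rw [← hmp.symm.integral_comp (MeasurableEquiv.measurableEmbedding _)]
      simp_rw [piFinSucc_symm, hP]
    have hcons : Measurable (fun p : E × (Fin n → E) => (Fin.cons p.1 p.2 : Fin (n + 1) → E)) := by
      simp_rw [← piFinSucc_symm]
      exact (MeasurableEquiv.piFinSuccAbove (fun _ : Fin (n + 1) => E) 0).symm.measurable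
    have hFc : Measurable (fun p : E × (Fin n → E) => F (Fin.cons p.1 p.2)) := hF.comp hcons
    have hFi : Integrable (fun p : E × (Fin n → E) => F (Fin.cons p.1 p.2)) (μ.prod P) :=
      Integrable.of_bound hFc.aestronglyMeasurable B (Eventually.of_forall fun p => hB _)
    set G : (Fin n → E) → ℝ := fun w => ∫ e, F (Fin.cons e w) ∂μ with hG
    have hGm : Measurable G := by
      have : StronglyMeasurable (fun p : (Fin n → E) × E => F (Fin.cons p.2 p.1)) :=
        (hFc.comp measurable_swap).stronglyMeasurable
      exact this.integral_prod_right'.measurable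
    have hsec : ∀ w, Measurable (fun e => F (Fin.cons e w)) := fun w =>
      hFc.comp (measurable_id.prodMk measurable_const)
    have hsi : ∀ w, Integrable (fun e => F (Fin.cons e w)) μ := fun w =>
      Integrable.of_bound (hsec w).aestronglyMeasurable B (Eventually.of_forall fun p => hB _)
    have hGB : ∀ w, |G w| ≤ B := by
      intro w
      have := norm_integral_le_of_norm_le_const (μ := μ) (f := fun e => F (Fin.cons e w)) (C := B)
        (Eventually.of_forall fun e => hB _)
      simpa using this
    have hGd : ∀ w i e, |G (Function.update w i e) - G w| ≤ c := by
      intro w i e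
      rw [hG]; simp only
      rw [← integral_sub (hsi _) (hsi _)]
      have := norm_integral_le_of_norm_le_const (μ := μ)
        (f := fun e' => F (Fin.cons e' (Function.update w i e)) - F (Fin.cons e' w)) (C := c)
        (Eventually.of_forall fun e' => by
          rw [Fin.cons_update]; exact hd _ _ _)
      simpa using this
    have hEF : ∫ w', F w' ∂(Measure.pi fun _ : Fin (n + 1) => μ) = ∫ w, G w ∂P := by
      rw [key, integral_prod_symm _ hFi]
    rw [hEF]
    set m := ∫ w, G w ∂P with hm
    rw [key]
    have hexpm : Measurable (fun p : E × (Fin n → E) => Real.exp (t * (F (Fin.cons p.1 p.2) - m))) :=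
      by fun_prop
    have hexpi : Integrable (fun p : E × (Fin n → E) =>
        Real.exp (t * (F (Fin.cons p.1 p.2) - m))) (μ.prod P) := by
      refine Integrable.of_bound hexpm.aestronglyMeasurable (Real.exp (|t| * (B + |m|)))
        (Eventually.of_forall fun p => ?_)
      rw [Real.norm_of_nonneg (Real.exp_pos _).le]
      apply Real.exp_le_exp.2
      refine (le_abs_self _).trans ?_
      rw [abs_mul]
      gcongr
      exact (abs_sub _ _).trans (by gcongr; exact hB _)
    rw [integral_prod_symm _ hexpi]
    have hin : ∀ w, ∫ e, Real.exp (t * (F (Fin.cons e w) - m)) ∂μ ≤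
        Real.exp (t * (G w - m)) * Real.exp (c ^ 2 * t ^ 2 / 2) := by
      intro w
      have hne : Nonempty E := by
        by_contra h
        rw [not_nonempty_iff] at h
        have := (measure_univ (μ := μ))
        rw [Set.univ_eq_empty_iff.2 h] at this
        simp at this
      obtain ⟨e0⟩ := hne
      have hmem : ∀ e, F (Fin.cons e w) ∈
          Set.Icc (F (Fin.cons e0 w) - c) (F (Fin.cons e0 w) + c) := by
        intro e
        have := hd (Fin.cons e0 w) 0 e
        rw [Fin.update_cons_zero, abs_le] at this
        constructor <;> linarith [this.1, this.2]
      have hsg := (hasSubgaussianMGF_of_mem_Icc (μ := μ) (hsec w).aemeasurable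
        (Eventually.of_forall hmem)).mgf_le t
      have e1 : ∀ e, Real.exp (t * (F (Fin.cons e w) - m)) =
          Real.exp (t * (G w - m)) * Real.exp (t * (F (Fin.cons e w) - G w)) := by
        intro e; rw [← Real.exp_add]; ring_nf
      simp_rw [e1]
      rw [integral_const_mul]
      gcongr
      refine hsg.trans (le_of_eq ?_)
      congr 2
      simp only [NNReal.coe_pow, NNReal.coe_div, coe_nnnorm, NNReal.coe_ofNat]
      have : F (Fin.cons e0 w) + c - (F (Fin.cons e0 w) - c) = 2 * c := by ring
      rw [this, Real.norm_eq_abs, abs_mul, abs_two, mul_div_cancel_left₀ _ two_ne_zero, sq_abs]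
    calc ∫ w, ∫ e, Real.exp (t * (F (Fin.cons e w) - m)) ∂μ ∂P
        ≤ ∫ w, Real.exp (t * (G w - m)) * Real.exp (c ^ 2 * t ^ 2 / 2) ∂P := by
          refine integral_mono hexpi.integral_prod_right ?_ hin
          refine Integrable.mul_const ?_ _
          refine Integrable.of_bound (by fun_prop) (Real.exp (|t| * (B + |m|)))
            (Eventually.of_forall fun p => ?_)
          rw [Real.norm_of_nonneg (Real.exp_pos _).le]
          apply Real.exp_le_exp.2
          refine (le_abs_self _).trans ?_
          rw [abs_mul]
          gcongr
          exact (abs_sub _ _).trans (by gcongr; exact hGB _)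
      _ ≤ Real.exp (n * c ^ 2 * t ^ 2 / 2) * Real.exp (c ^ 2 * t ^ 2 / 2) := by
          rw [integral_mul_const]
          gcongr
          exact ih G hGm ⟨B, hGB⟩ hGd t
      _ = _ := by
          rw [← Real.exp_add]; push_cast; ring_nf

lemma mcd {E : Type} [MeasurableSpace E] (μ : Measure E) [IsProbabilityMeasure μ] (c : ℝ)
    (n : ℕ) (F : (Fin n → E) → ℝ) (hF : Measurable F) (hB : ∃ B, ∀ w, |F w| ≤ B)
    (hd : ∀ w i e, |F (Function.update w i e) - F w| ≤ c) (ε : ℝ) (hε : 0 ≤ ε) :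
    (Measure.pi fun _ : Fin n => μ).real
      {w | ε ≤ |F w - ∫ w', F w' ∂(Measure.pi fun _ : Fin n => μ)|} ≤
      2 * Real.exp (- ε ^ 2 / (2 * (n * c ^ 2))) := by
  set P := Measure.pi fun _ : Fin n => μ with hP
  have one : ∀ F : (Fin n → E) → ℝ, Measurable F → (∃ B, ∀ w, |F w| ≤ B) →
      (∀ w i e, |F (Function.update w i e) - F w| ≤ c) →
      P.real {w | ε ≤ F w - ∫ w', F w' ∂P} ≤ Real.exp (- ε ^ 2 / (2 * (n * c ^ 2))) := by
    intro F hF hB hd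
    have hsub : HasSubgaussianMGF (fun w => F w - ∫ w', F w' ∂P)
        (⟨n * c ^ 2, by positivity⟩ : NNReal) P := by
      constructor
      · intro t
        obtain ⟨B, hB⟩ := hB
        refine Integrable.of_bound (by fun_prop) (Real.exp (|t| * (B + |∫ w', F w' ∂P|)))
            (Eventually.of_forall fun p => ?_)
        rw [Real.norm_of_nonneg (Real.exp_pos _).le]
        apply Real.exp_le_exp.2
        refine (le_abs_self _).trans ?_
        rw [abs_mul]
        gcongr
        exact (abs_sub _ _).trans (by gcongr; exact hB _)
      · intro t
        exact mcd_aux μ c n F hF hB hd t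
    exact hsub.measure_ge_le hε
  have h1 := one F hF hB hd
  have h2 := one (fun w => - F w) hF.neg (by simpa using hB)
    (fun w i e => by
      have := hd w i e
      rw [abs_sub_comm] at this
      convert this using 2; ring)
  rw [integral_neg] at h2
  have hsub : {w | ε ≤ |F w - ∫ w', F w' ∂P|} ⊆
      {w | ε ≤ F w - ∫ w', F w' ∂P} ∪ {w | ε ≤ - F w - -∫ w', F w' ∂P} := by
    intro w hw
    rw [Set.mem_ofPred_eq] at hw
    rcases le_abs.1 hw with h | h
    · exact Or.inl h
    · exact Or.inr (by change ε ≤ _; linarith)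
  calc _ ≤ _ := measureReal_mono hsub
    _ ≤ _ := measureReal_union_le _ _
    _ ≤ _ := by linarith

lemma exists_meas_version (f : ℂ → ℝ) (hf0 : ∀ x, 0 ≤ f x) (hfb : ∃ C, ∀ x, f x ≤ C)
    (hfc : ∀ᵐ x : ℂ, ContinuousAt f x) :
    ∃ f' : ℂ → ℝ, Measurable f' ∧ (∀ x, 0 ≤ f' x) ∧ (∃ C, ∀ x, f' x ≤ C) ∧
      (∀ᵐ x : ℂ, ContinuousAt f' x) ∧ (∀ᵐ x : ℂ, f' x = f x) := by
  obtain ⟨C, hC⟩ := hfb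
  set g : ℕ → ℂ → ENNReal := fun m x =>
    ⨆ y ∈ Metric.ball x (1 / ((m : ℝ) + 1)), ENNReal.ofReal (f y) with hg
  set F : ℂ → ENNReal := fun x => ⨅ m, g m x with hF
  have hgm : ∀ m, Measurable (g m) := by
    intro m
    refine measurable_of_Ioi fun c => IsOpen.measurableSet ?_
    have : g m ⁻¹' Ioi c = ⋃ y ∈ {y | c < ENNReal.ofReal (f y)},
        Metric.ball y (1 / ((m : ℝ) + 1)) := by
      ext x
      simp only [hg, Set.mem_preimage, Set.mem_Ioi, lt_iSup_iff, Set.mem_iUnion,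
        Metric.mem_ball, Set.mem_ofPred_eq, exists_prop]
      constructor
      · rintro ⟨y, h1, h2⟩; exact ⟨y, h2, by rwa [dist_comm]⟩
      · rintro ⟨y, h1, h2⟩; exact ⟨y, by rwa [dist_comm], h1⟩
    rw [this]
    exact isOpen_biUnion fun y _ => Metric.isOpen_ball
  have hFm : Measurable F := Measurable.iInf hgm
  have hFle : ∀ x, F x ≤ ENNReal.ofReal C := by
    intro x
    refine (iInf_le _ 0).trans ?_
    exact iSup₂_le fun y _ => ENNReal.ofReal_le_ofReal (hC y)
  have hFge : ∀ x, ENNReal.ofReal (f x) ≤ F x := by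
    intro x
    refine le_iInf fun m => ?_
    exact le_iSup₂ (f := fun y (_ : y ∈ Metric.ball x (1 / ((m : ℝ) + 1))) => ENNReal.ofReal (f y)) x
      (Metric.mem_ball_self (by positivity))
  have hFt : ∀ x, ContinuousAt f x → Tendsto F (𝓝 x) (𝓝 (ENNReal.ofReal (f x))) := by
    intro x hx
    have hx' : Tendsto (fun y => ENNReal.ofReal (f y)) (𝓝 x) (𝓝 (ENNReal.ofReal (f x))) :=
      (ENNReal.continuous_ofReal.tendsto _).comp hx
    rw [tendsto_order] at hx' ⊢
    refine ⟨fun b hb => ?_, fun b hb => ?_⟩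
    · filter_upwards [hx'.1 b hb] with y hy using hy.trans_le (hFge y)
    · obtain ⟨b', h1, h2⟩ := exists_between hb
      obtain ⟨δ, hδ, h⟩ := Metric.eventually_nhds_iff.1 (hx'.2 b' h1)
      obtain ⟨m, hm⟩ := exists_nat_one_div_lt (half_pos hδ)
      filter_upwards [Metric.ball_mem_nhds x (half_pos hδ)] with y hy
      refine lt_of_le_of_lt ((iInf_le _ m).trans (iSup₂_le fun z hz => ?_)) h2
      refine (h ?_).le
      rw [Metric.mem_ball] at hy hz
      calc dist z x ≤ dist z y + dist y x := dist_triangle _ _ _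
        _ < δ := by linarith
  have hFx : ∀ x, ContinuousAt f x → F x = ENNReal.ofReal (f x) := fun x hx =>
    tendsto_nhds_unique (tendsto_pure_nhds F x) ((hFt x hx).mono_left (pure_le_nhds x))
  refine ⟨fun x => (F x).toReal, hFm.ennreal_toReal, fun x => ENNReal.toReal_nonneg,
    ⟨(ENNReal.ofReal C).toReal, fun x => ENNReal.toReal_mono ENNReal.ofReal_ne_top (hFle x)⟩, ?_, ?_⟩
  · filter_upwards [hfc] with x hx
    have := hFt x hx
    rw [← hFx x hx] at this
    exact (ENNReal.tendsto_toReal ((hFle x).trans_lt ENNReal.ofReal_lt_top).ne).comp this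
  · filter_upwards [hfc] with x hx
    rw [hFx x hx, ENNReal.toReal_ofReal (hf0 x)]

lemma vol_sector_sym {a : ℝ} (ha : 0 < a) (ha' : a ≤ 2 * π) :
    volume (sector a 0 (-a/2) 1) = ENNReal.ofReal (a / 2) := by
  have hS := measurableSet_sector a 1 0 (-a/2)
  rw [← lintegral_indicator_one hS, ← Complex.lintegral_comp_polarCoord_symm]
  have hmem : ∀ p ∈ polarCoord.target, (Complex.polarCoord.symm p ∈ sector a 0 (-a/2) 1 ↔
      p ∈ (Set.Ioc (0:ℝ) 1 ×ˢ (Set.Icc (-a/2) (a/2) : Set ℝ))) := by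
    rintro ⟨ρ, θ⟩ hp
    simp only [polarCoord_target, Set.mem_prod, Set.mem_Ioi, Set.mem_Ioo] at hp
    obtain ⟨h1, h2, h3⟩ := hp
    have e1 : Complex.polarCoord.symm (ρ, θ) = ρ * Complex.exp (θ * Complex.I) := by
      rw [Complex.polarCoord_symm_apply, Complex.exp_mul_I]; push_cast; rfl
    have e2 : ‖(ρ:ℂ) * Complex.exp (θ * Complex.I)‖ = ρ := by
      rw [norm_mul, Complex.norm_exp_ofReal_mul_I, mul_one, Complex.norm_real,
        Real.norm_of_nonneg h1.le]
    have hne : (ρ : ℂ) ≠ 0 := by exact_mod_cast h1.ne'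
    simp only [sector, Set.mem_ofPred_eq, sub_zero, e1, e2, Set.mem_prod, Set.mem_Ioc, Set.mem_Icc]
    constructor
    · rintro ⟨h4, t, h5, h6, h7⟩
      refine ⟨⟨h1, h4⟩, ?_⟩
      have h8 := mul_left_cancel₀ hne h7
      rw [Complex.exp_eq_exp_iff_exists_int] at h8
      obtain ⟨m, hm⟩ := h8
      have h9 : θ = t + m * (2 * π) := by
        have : (θ : ℂ) = ((t + m * (2 * π) : ℝ) : ℂ) := by
          have hI : Complex.I ≠ 0 := Complex.I_ne_zero
          apply mul_right_cancel₀ hI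
          rw [hm]; push_cast; ring
        exact_mod_cast this
      have hm0 : m = 0 := by
        have hpi := Real.pi_pos
        have ha1 : |(m:ℝ) * (2 * π)| < 1 * (2 * π) := by
          rw [abs_lt]; constructor <;> linarith
        rw [abs_mul, abs_of_pos (by positivity : 0 < 2 * π)] at ha1
        have := lt_of_mul_lt_mul_right ha1 (by positivity)
        have h10 : |m| < 1 := by exact_mod_cast this
        exact Int.abs_lt_one_iff.1 h10
      rw [hm0] at h9
      simp at h9
      rw [h9]; constructor <;> linarith
    · rintro ⟨⟨_, h4⟩, h5, h6⟩
      exact ⟨h4, θ, h5, by linarith, rfl⟩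
  set A : Set ℝ := Set.Icc (-a/2) (a/2) ∩ Set.Ioo (-π) π with hA
  have hvA : volume A = ENNReal.ofReal a := by
    apply le_antisymm
    · refine (measure_mono Set.inter_subset_left).trans ?_
      rw [Real.volume_Icc]; apply ENNReal.ofReal_le_ofReal; linarith
    · have : Set.Ioo (-a/2) (a/2) ⊆ A := by
        intro x hx
        exact ⟨⟨hx.1.le, hx.2.le⟩, by linarith [hx.1], by linarith [hx.2]⟩
      refine le_trans ?_ (measure_mono this)
      rw [Real.volume_Ioo]; apply ENNReal.ofReal_le_ofReal; linarith
  have hAm : MeasurableSet A := measurableSet_Icc.inter measurableSet_Ioo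
  have e3 : ∫⁻ p in polarCoord.target, ENNReal.ofReal p.1 •
      (sector a 0 (-a/2) 1).indicator 1 (Complex.polarCoord.symm p) =
      ∫⁻ p : ℝ × ℝ, (Set.Ioc (0:ℝ) 1).indicator (fun ρ => ENNReal.ofReal ρ) p.1 * A.indicator 1 p.2 := by
    rw [← lintegral_indicator (by
      rw [polarCoord_target]; exact measurableSet_Ioi.prod measurableSet_Ioo)]
    congr 1
    ext p
    by_cases hp : p ∈ polarCoord.target
    · rw [Set.indicator_of_mem hp]
      have hm := hmem p hp
      have hp' := hp
      rw [polarCoord_target] at hp'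
      by_cases hs : Complex.polarCoord.symm p ∈ sector a 0 (-a/2) 1
      · rw [Set.indicator_of_mem hs]
        obtain ⟨h1, h2⟩ := hm.1 hs
        rw [Set.indicator_of_mem h1, Set.indicator_of_mem (show p.2 ∈ A from ⟨h2, hp'.2⟩)]
        simp
      · rw [Set.indicator_of_notMem hs]
        by_cases h1 : p.1 ∈ Set.Ioc (0:ℝ) 1
        · have h2 : p.2 ∉ A := fun h => hs (hm.2 ⟨h1, h.1⟩)
          rw [Set.indicator_of_notMem h2]; simp
        · rw [Set.indicator_of_notMem h1]; simp
    · rw [Set.indicator_of_notMem hp]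
      symm
      by_cases h1 : p.1 ∈ Set.Ioc (0:ℝ) 1
      · have h2 : p.2 ∉ A := fun h => hp (by rw [polarCoord_target]; exact ⟨h1.1, h.2⟩)
        rw [Set.indicator_of_notMem h2]; simp
      · rw [Set.indicator_of_notMem h1]; simp
  rw [e3, Measure.volume_eq_prod, lintegral_prod_mul (f := fun ρ : ℝ => (Set.Ioc (0:ℝ) 1).indicator (fun ρ => ENNReal.ofReal ρ) ρ) (g := A.indicator 1), lintegral_indicator_one hAm, hvA,
    lintegral_indicator measurableSet_Ioc]
  · rw [← ofReal_integral_eq_lintegral_ofReal, ← intervalIntegral.integral_of_le zero_le_one,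
      integral_id, ← ENNReal.ofReal_mul (by norm_num)]
    · congr 1; ring
    · exact (continuous_id.integrableOn_Icc (a := (0:ℝ)) (b := 1)).mono_set Set.Ioc_subset_Icc_self
    · filter_upwards [ae_restrict_mem measurableSet_Ioc] with x hx using hx.1.le
  · exact (ENNReal.measurable_ofReal.indicator measurableSet_Ioc).aemeasurable
  · exact (measurable_one.indicator hAm).aemeasurable

lemma vol_sector {a : ℝ} (ha : 0 < a) (ha' : a ≤ 2 * π) (x : ℂ) (y : ℝ) :
    volume (sector a x y 1) = ENNReal.ofReal (a / 2) := by
  rw [← vol_sector_sym ha ha']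
  have h1 : MeasurePreserving (fun z : ℂ => z - x) volume volume := measurePreserving_sub_right _ x
  set u : Circle := Circle.exp (-(y + a / 2)) with hu
  have h2 : MeasurePreserving (rotation u) volume volume := (rotation u).measurePreserving
  have h3 := (h2.comp h1).measure_preimage (measurableSet_sector a 1 0 (-a/2)).nullMeasurableSet
  rw [← h3]
  congr 1
  ext z
  have e1 : ((rotation u) ∘ fun z : ℂ => z - x) z =
      Complex.exp (((-(y + a / 2) : ℝ) : ℂ) * Complex.I) * (z - x) := by
    rw [Function.comp_apply, rotation_apply, hu, Circle.coe_exp]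
  simp only [Set.mem_preimage, e1, sector, Set.mem_ofPred_eq, sub_zero, norm_mul,
    Complex.norm_exp_ofReal_mul_I, one_mul]
  refine and_congr Iff.rfl ?_
  constructor
  · rintro ⟨t, h4, h5, h6⟩
    refine ⟨t - (y + a / 2), by linarith, by linarith, ?_⟩
    conv_lhs => rw [h6]
    rw [mul_left_comm, ← Complex.exp_add]
    congr 2; push_cast; ring
  · rintro ⟨t, h4, h5, h6⟩
    refine ⟨t + (y + a / 2), by linarith, by linarith, ?_⟩
    apply mul_left_cancel₀ (Complex.exp_ne_zero (((-(y + a / 2) : ℝ) : ℂ) * Complex.I))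
    rw [h6]
    rw [mul_left_comm, ← Complex.exp_add]
    congr 2; push_cast; ring

lemma phiT_eq {a : ℝ} (ha : 0 < a) (ha' : a ≤ 2 * π) (d : ℕ)
    (T : Fin (d + 1) → Fin (d + 1) → Prop) (hT : ∀ i, ¬ T i i) (t : ℝ) :
    phiT a (d + 1) T t = (t ^ d / (d.factorial * (2 * π) ^ (d + 1))) *
    ∫ y in Set.univ.pi (fun _ : Fin (d + 1) => Set.Ico 0 (2 * π)),
      ∫ z : Fin d → ℂ,
        hInd a T (pts (k := d + 1) z) y * Real.exp (-t * sectorUnionVol a (pts (k := d + 1) z) y) := by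
  unfold phiT
  rcases Nat.eq_zero_or_pos d with rfl | hd
  · have e : ∀ (z : Fin 0 → ℂ) (y : Fin 1 → ℝ),
        hInd a T (pts (k := 1) z) y * Real.exp (-t * sectorUnionVol a (pts (k := 1) z) y) =
        Real.exp (-(t * a) / 2) := by
      intro z y
      have h1 : hInd a T (pts (k := 1) z) y = 1 := by
        unfold hInd
        rw [if_pos]
        refine ⟨Equiv.refl _, fun i j => ?_⟩
        have hij : i = j := by apply Fin.ext; omega
        subst hij
        simp [hT, arc]
      have h2 : sectorUnionVol a (pts (k := 1) z) y = a / 2 := by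
        unfold sectorUnionVol
        have hU : (⋃ i : Fin (0 + 1), sector a (pts (k := 1) z i) (y i) 1) =
            sector a (pts (k := 1) z 0) (y 0) 1 := by
          ext p; simp
        rw [hU, vol_sector ha ha', ENNReal.toReal_ofReal (by linarith)]
      rw [h1, h2, one_mul]; congr 1; ring
    simp_rw [e]
    have hv : (volume : Measure (Fin 1 → ℝ)).real
        (Set.univ.pi (fun _ : Fin 1 => Set.Ico 0 (2 * π))) = 2 * π := by
      rw [Measure.real, volume_pi_pi]
      simp [Real.pi_pos.le]
    have hv0 : (volume : Measure (Fin 0 → ℂ)).real Set.univ = 1 := by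
      rw [Measure.real, ← Set.pi_univ Set.univ, volume_pi_pi]; simp
    simp only [integral_const, smul_eq_mul, measureReal_restrict_apply_univ, zero_add, hv, hv0]
    have := Real.pi_pos
    simp
    field_simp
  · rw [if_neg (by omega)]
    rfl

open Classical in
/-- Number of points within distance `ρ` of vertex `v` (including itself). -/
def Dcnt (ρ : ℝ) {n : ℕ} (w : Fin n → ℂ × ℝ) (v : Fin n) : ℕ :=
  (Finset.univ.filter fun j => ‖(w j).1 - (w v).1‖ ≤ ρ).card

/-- Truncated version of `Good`. -/
def GK (a r ρ : ℝ) (K : ℕ) {d n : ℕ} (T : Fin (d + 1) → Fin (d + 1) → Prop)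
    (g : Fin (d + 1) ↪ Fin n) (w : Fin n → ℂ × ℝ) : Prop :=
  Good a r T g w ∧ Dcnt ρ w (g 0) ≤ K

open Classical in
/-- Truncated count. -/
def FK (a r ρ : ℝ) (K : ℕ) {d n : ℕ} (T : Fin (d + 1) → Fin (d + 1) → Prop)
    (w : Fin n → ℂ × ℝ) : ℝ :=
  ((Finset.univ.filter fun g : Fin (d + 1) ↪ Fin n => GK a r ρ K T g w).card : ℝ)

open Classical in
/-- Full count. -/
def FH (a r : ℝ) {d n : ℕ} (T : Fin (d + 1) → Fin (d + 1) → Prop)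
    (w : Fin n → ℂ × ℝ) : ℝ :=
  ((Finset.univ.filter fun g : Fin (d + 1) ↪ Fin n => Good a r T g w).card : ℝ)

lemma measurable_Dcnt (ρ : ℝ) {n : ℕ} (v : Fin n) :
    Measurable (fun w : Fin n → ℂ × ℝ => Dcnt ρ w v) := by
  classical
  have : ∀ w : Fin n → ℂ × ℝ, Dcnt ρ w v = ∑ j, if ‖(w j).1 - (w v).1‖ ≤ ρ then 1 else 0 := by
    intro w
    rw [Dcnt, Finset.card_filter]
  simp_rw [this]
  refine Finset.measurable_sum _ fun j _ => ?_
  refine Measurable.ite (measurableSet_le (by fun_prop) (by fun_prop)) measurable_const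
    measurable_const

lemma measurableSet_GK (a r ρ : ℝ) (K : ℕ) {d n : ℕ} (T : Fin (d + 1) → Fin (d + 1) → Prop)
    (g : Fin (d + 1) ↪ Fin n) : MeasurableSet {w : Fin n → ℂ × ℝ | GK a r ρ K T g w} :=
  (measurableSet_Good a r T g).inter (measurableSet_le (measurable_Dcnt ρ (g 0)) measurable_const)

lemma measurable_FK (a r ρ : ℝ) (K : ℕ) {d n : ℕ} (T : Fin (d + 1) → Fin (d + 1) → Prop) :
    Measurable (fun w : Fin n → ℂ × ℝ => FK a r ρ K T w) := by
  classical
  simp only [FK, Finset.card_filter]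
  push_cast
  refine Finset.measurable_sum _ fun g _ => ?_
  exact Measurable.ite (measurableSet_GK a r ρ K T g) measurable_const measurable_const

lemma measurable_FH (a r : ℝ) {d n : ℕ} (T : Fin (d + 1) → Fin (d + 1) → Prop) :
    Measurable (fun w : Fin n → ℂ × ℝ => FH a r T w) := by
  classical
  simp only [FH, Finset.card_filter]
  push_cast
  refine Finset.measurable_sum _ fun g _ => ?_
  exact Measurable.ite (measurableSet_Good a r T g) measurable_const measurable_const

lemma FH_le (a r : ℝ) {d n : ℕ} (T : Fin (d + 1) → Fin (d + 1) → Prop)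
    (w : Fin n → ℂ × ℝ) : FH a r T w ≤ (n : ℝ) ^ (d + 1) := by
  classical
  have h1 := Finset.card_filter_le (Finset.univ : Finset (Fin (d + 1) ↪ Fin n))
    (fun g => Good a r T g w)
  rw [Finset.card_univ, Fintype.card_embedding_eq, Fintype.card_fin, Fintype.card_fin] at h1
  have h2 := h1.trans (Nat.descFactorial_le_pow n (d + 1))
  unfold FH
  exact_mod_cast h2

lemma FK_le_FH (a r ρ : ℝ) (K : ℕ) {d n : ℕ} (T : Fin (d + 1) → Fin (d + 1) → Prop)
    (w : Fin n → ℂ × ℝ) : FK a r ρ K T w ≤ FH a r T w := by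
  classical
  unfold FK FH
  have : (Finset.univ.filter fun g : Fin (d + 1) ↪ Fin n => GK a r ρ K T g w).card ≤
      (Finset.univ.filter fun g : Fin (d + 1) ↪ Fin n => Good a r T g w).card :=
    Finset.card_le_card (Finset.monotone_filter_right _ fun g _ h => h.1)
  exact_mod_cast this

lemma FK_eq_FH (a r ρ : ℝ) (K : ℕ) {d n : ℕ} (T : Fin (d + 1) → Fin (d + 1) → Prop)
    (w : Fin n → ℂ × ℝ) (h : ∀ v, Dcnt ρ w v ≤ K) : FK a r ρ K T w = FH a r T w := by
  classical
  unfold FK FH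
  simp [GK, h]

lemma Good_near {a r : ℝ} (hr : 0 ≤ r) {d n : ℕ} {T : Fin (d + 1) → Fin (d + 1) → Prop}
    (hT : (SimpleGraph.fromRel T).Connected)
    {g : Fin (d + 1) ↪ Fin n} {w : Fin n → ℂ × ℝ} (h : Good a r T g w) (i : Fin (d + 1)) :
    ‖(w (g i)).1 - (w (g 0)).1‖ ≤ (d + 2) * r := by
  have := Iso_bound hr hT h.1 i 0
  push_cast at this
  refine this.trans ?_
  nlinarith

open Classical in
lemma card_near {ρ : ℝ} (hρ : 0 < ρ) {K n : ℕ} (w : Fin n → ℂ × ℝ) (p : ℂ) :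
    (Finset.univ.filter fun v : Fin n => Dcnt ρ w v ≤ K ∧ ‖(w v).1 - p‖ ≤ ρ).card ≤ K * 25 := by
  set V := Finset.univ.filter fun v : Fin n => Dcnt ρ w v ≤ K ∧ ‖(w v).1 - p‖ ≤ ρ with hV
  set c : Fin n → ℤ × ℤ := fun v =>
    (⌊2 * ((w v).1 - p).re / ρ⌋, ⌊2 * ((w v).1 - p).im / ρ⌋) with hc
  have hmaps : ∀ v ∈ V, c v ∈ (Finset.Icc (-2 : ℤ) 2) ×ˢ (Finset.Icc (-2 : ℤ) 2) := by
    intro v hv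
    have h2 := (Finset.mem_filter.1 hv).2.2
    have key : ∀ s : ℝ, |s| ≤ ρ → ⌊2 * s / ρ⌋ ∈ Finset.Icc (-2 : ℤ) 2 := by
      intro s hs
      rw [abs_le] at hs
      rw [Finset.mem_Icc, Int.le_floor, ← Int.lt_add_one_iff, Int.floor_lt]
      constructor
      · rw [le_div_iff₀ hρ]; push_cast; linarith
      · rw [div_lt_iff₀ hρ]; push_cast; linarith
    exact Finset.mem_product.2 ⟨key _ ((Complex.abs_re_le_norm _).trans h2),
      key _ ((Complex.abs_im_le_norm _).trans h2)⟩
  have hfib : ∀ b ∈ (Finset.Icc (-2 : ℤ) 2) ×ˢ (Finset.Icc (-2 : ℤ) 2),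
      (V.filter fun v => c v = b).card ≤ K := by
    intro b _
    rcases (V.filter fun v => c v = b).eq_empty_or_nonempty with h | ⟨v, hv⟩
    · rw [h]; simp
    · obtain ⟨hv1, hv2⟩ := Finset.mem_filter.1 hv
      refine le_trans (Finset.card_le_card ?_) (Finset.mem_filter.1 hv1).2.1
      intro u hu
      obtain ⟨hu1, hu2⟩ := Finset.mem_filter.1 hu
      rw [Finset.mem_filter]
      refine ⟨Finset.mem_univ _, ?_⟩
      have he : c u = c v := hu2.trans hv2.symm
      rw [hc] at he
      simp only [Prod.mk.injEq] at he
      have key : ∀ s t : ℝ, ⌊2 * s / ρ⌋ = ⌊2 * t / ρ⌋ → |s - t| ≤ ρ / 2 := by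
        intro s t hst
        have := Int.abs_sub_lt_one_of_floor_eq_floor hst
        rw [← sub_div, abs_div, abs_of_pos hρ, div_lt_iff₀ hρ, ← mul_sub, abs_mul, abs_two] at this
        linarith
      have k1 := key _ _ he.1
      have k2 := key _ _ he.2
      refine (Complex.norm_le_abs_re_add_abs_im _).trans ?_
      simp only [Complex.sub_re, Complex.sub_im] at k1 k2 ⊢
      rw [sub_sub_sub_cancel_right] at k1 k2
      linarith
  have := Finset.card_le_mul_card_image_of_maps_to hmaps K hfib
  simpa using this

open Classical in
lemma card_GK_near {a r : ℝ} (hr : 0 < r) {K d n : ℕ} {T : Fin (d + 1) → Fin (d + 1) → Prop}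
    (hT : (SimpleGraph.fromRel T).Connected) (w : Fin n → ℂ × ℝ) (p : ℂ) :
    (Finset.univ.filter fun g : Fin (d + 1) ↪ Fin n =>
      GK a r ((d + 2) * r) K T g w ∧ ‖(w (g 0)).1 - p‖ ≤ (d + 2) * r).card
      ≤ 25 * K ^ (d + 2) := by
  set ρ := ((d : ℝ) + 2) * r with hρ
  have hρ0 : 0 < ρ := by positivity
  set V := Finset.univ.filter fun v : Fin n => Dcnt ρ w v ≤ K ∧ ‖(w v).1 - p‖ ≤ ρ with hV
  have hVc : V.card ≤ K * 25 := card_near hρ0 w p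
  set G := Finset.univ.filter fun g : Fin (d + 1) ↪ Fin n =>
      GK a r ρ K T g w ∧ ‖(w (g 0)).1 - p‖ ≤ ρ with hG
  have hmaps : ∀ g ∈ G, g 0 ∈ V := by
    intro g hg
    have := (Finset.mem_filter.1 hg).2
    exact Finset.mem_filter.2 ⟨Finset.mem_univ _, this.1.2, this.2⟩
  have hfib : ∀ v ∈ V, (G.filter fun g => g 0 = v).card ≤ K ^ (d + 1) := by
    intro v hv
    set N := Finset.univ.filter fun j => ‖(w j).1 - (w v).1‖ ≤ ρ with hN
    have hNc : N.card ≤ K := (Finset.mem_filter.1 hv).2.1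
    calc (G.filter fun g => g 0 = v).card
        ≤ (Fintype.piFinset fun _ : Fin (d + 1) => N).card := by
          refine Finset.card_le_card_of_injOn (fun g => (g : Fin (d + 1) → Fin n)) ?_ ?_
          · intro g hg
            obtain ⟨hg1, hg2⟩ := Finset.mem_filter.1 hg
            have hg3 := (Finset.mem_filter.1 hg1).2.1.1
            rw [Finset.mem_coe, Fintype.mem_piFinset]
            intro i
            rw [hN, Finset.mem_filter]
            refine ⟨Finset.mem_univ _, ?_⟩
            rw [← hg2]
            exact Good_near hr.le hT hg3 i
          · intro g _ g' _ h
            exact DFunLike.coe_injective h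
      _ = N.card ^ (d + 1) := by simp
      _ ≤ K ^ (d + 1) := Nat.pow_le_pow_left hNc _
  have h1 := Finset.card_le_mul_card_image_of_maps_to hmaps _ hfib
  calc G.card ≤ K ^ (d + 1) * V.card := h1
    _ ≤ K ^ (d + 1) * (K * 25) := Nat.mul_le_mul_left _ hVc
    _ = 25 * K ^ (d + 2) := by ring

lemma GK_update {a r : ℝ} (hr : 0 < r) {K d n : ℕ} {T : Fin (d + 1) → Fin (d + 1) → Prop}
    (hT : (SimpleGraph.fromRel T).Connected) (w : Fin n → ℂ × ℝ) (i : Fin n) (e : ℂ × ℝ)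
    (g : Fin (d + 1) ↪ Fin n) (h : GK a r ((d + 2) * r) K T g w)
    (h1 : ¬ ‖(w (g 0)).1 - (w i).1‖ ≤ (d + 2) * r) (h2 : ¬ ‖(w (g 0)).1 - e.1‖ ≤ (d + 2) * r) :
    GK a r ((d + 2) * r) K T g (Function.update w i e) := by
  classical
  rw [norm_sub_rev] at h1 h2
  have hi : ∀ j, g j ≠ i := by
    rintro j rfl
    exact h1 (Good_near hr.le hT h.1 j)
  have hw : (fun j => Function.update w i e (g j)) = fun j => w (g j) := by
    ext1 j; rw [Function.update_of_ne (hi j)]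
  refine ⟨⟨?_, ?_⟩, ?_⟩
  · rw [hw]; exact h.1.1
  · rw [hw]
    intro j hj
    by_cases hji : j = i
    · subst hji
      rw [Function.update_self]
      intro hmem
      obtain ⟨l, hl⟩ := SecU_bound hmem
      apply h2
      have hb := Iso_bound hr.le hT h.1.1 l 0
      have h3 : ‖e.1 - (w (g 0)).1‖ ≤ ‖e.1 - (w (g l)).1‖ + ‖(w (g l)).1 - (w (g 0)).1‖ := by
        have := norm_add_le (e.1 - (w (g l)).1) ((w (g l)).1 - (w (g 0)).1)
        simpa using this
      push_cast at hb
      linarith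
    · rw [Function.update_of_ne hji]; exact h.1.2 j hj
  · refine le_trans (le_of_eq ?_) h.2
    unfold Dcnt
    congr 1
    ext j
    simp only [Finset.mem_filter, Finset.mem_univ, true_and]
    rw [Function.update_of_ne (hi 0)]
    by_cases hji : j = i
    · subst hji
      rw [Function.update_self]
      exact ⟨fun h => absurd h h2, fun h => absurd h h1⟩
    · rw [Function.update_of_ne hji]

lemma FK_update_le {a r : ℝ} (hr : 0 < r) {K d n : ℕ} {T : Fin (d + 1) → Fin (d + 1) → Prop}
    (hT : (SimpleGraph.fromRel T).Connected) (w : Fin n → ℂ × ℝ) (i : Fin n) (e : ℂ × ℝ) :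
    FK a r ((d + 2) * r) K T w ≤
      FK a r ((d + 2) * r) K T (Function.update w i e) + 50 * (K : ℝ) ^ (d + 2) := by
  classical
  have hsub : (Finset.univ.filter fun g : Fin (d + 1) ↪ Fin n => GK a r ((d + 2) * r) K T g w) ⊆
      (Finset.univ.filter fun g : Fin (d + 1) ↪ Fin n =>
        GK a r ((d + 2) * r) K T g (Function.update w i e)) ∪
      ((Finset.univ.filter fun g : Fin (d + 1) ↪ Fin n =>
        GK a r ((d + 2) * r) K T g w ∧ ‖(w (g 0)).1 - (w i).1‖ ≤ (d + 2) * r) ∪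
      (Finset.univ.filter fun g : Fin (d + 1) ↪ Fin n =>
        GK a r ((d + 2) * r) K T g w ∧ ‖(w (g 0)).1 - e.1‖ ≤ (d + 2) * r)) := by
    intro g hg
    have hg := (Finset.mem_filter.1 hg).2
    simp only [Finset.mem_union, Finset.mem_filter, Finset.mem_univ, true_and]
    by_cases h1 : ‖(w (g 0)).1 - (w i).1‖ ≤ (d + 2) * r
    · exact Or.inr (Or.inl ⟨hg, h1⟩)
    by_cases h2 : ‖(w (g 0)).1 - e.1‖ ≤ (d + 2) * r
    · exact Or.inr (Or.inr ⟨hg, h2⟩)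
    exact Or.inl (GK_update hr hT w i e g hg h1 h2)
  have h1 := (Finset.card_le_card hsub).trans ((Finset.card_union_le _ _).trans
    (Nat.add_le_add_left (Finset.card_union_le _ _) _))
  have h2 := card_GK_near (a := a) (K := K) hr hT w (w i).1
  have h3 := card_GK_near (a := a) (K := K) hr hT w e.1
  have h4 := h1.trans (Nat.add_le_add_left (Nat.add_le_add h2 h3) _)
  unfold FK
  have h5 : ((Finset.univ.filter fun g : Fin (d + 1) ↪ Fin n =>
      GK a r ((d + 2) * r) K T g w).card : ℝ) ≤ _ := Nat.cast_le.2 h4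
  refine h5.trans (le_of_eq ?_)
  push_cast
  ring

lemma FK_diff {a r : ℝ} (hr : 0 < r) {K d n : ℕ} {T : Fin (d + 1) → Fin (d + 1) → Prop}
    (hT : (SimpleGraph.fromRel T).Connected) (w : Fin n → ℂ × ℝ) (i : Fin n) (e : ℂ × ℝ) :
    |FK a r ((d + 2) * r) K T (Function.update w i e) - FK a r ((d + 2) * r) K T w| ≤
      50 * (K : ℝ) ^ (d + 2) := by
  have h1 := FK_update_le (a := a) (K := K) hr hT w i e
  have h2 := FK_update_le (a := a) (K := K) hr hT (Function.update w i e) i (w i)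
  simp only [Function.update_idem, Function.update_eq_self] at h2
  rw [abs_le]; constructor <;> linarith

lemma split_mp {E : Type} [MeasurableSpace E] (μ : Measure E) [IsProbabilityMeasure μ] {k n : ℕ}
    (g : Fin k ↪ Fin n) :
    MeasurePreserving (fun w : Fin n → E => ((fun i => w (g i) : Fin k → E),
        (fun j => w j : {j // ¬ (j ∈ Set.range g)} → E)))
      (Measure.pi fun _ : Fin n => μ)
      ((Measure.pi fun _ : Fin k => μ).prod (Measure.pi fun _ : {j // ¬ (j ∈ Set.range g)} => μ)) := by
  classical
  have h1 := measurePreserving_piEquivPiSubtypeProd (fun _ : Fin n => μ) (fun j => j ∈ Set.range g)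
  let eg : {j // j ∈ Set.range g} ≃ Fin k := (Equiv.ofInjective g g.injective).symm
  have h2 := measurePreserving_piCongrLeft (fun _ : Fin k => μ) eg
  rw [Subsingleton.elim (Set.fintypeRange g) (Subtype.fintype fun j => j ∈ Set.range g)] at h2
  have h3 := (h2.prod (MeasurePreserving.id
    (Measure.pi fun _ : {j // ¬ (j ∈ Set.range g)} => μ))).comp h1
  convert h3 using 1
  ext1 w
  refine Prod.ext ?_ rfl
  ext1 i
  obtain ⟨j, rfl⟩ := eg.surjective i
  have hj : g (eg j) = j := by
    have := Equiv.apply_symm_apply (Equiv.ofInjective g g.injective) j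
    exact congrArg Subtype.val this
  simp only [Function.comp_apply, Prod.map_fst, MeasurableEquiv.coe_piCongrLeft]
  rw [Equiv.piCongrLeft_apply_apply, hj]
  rfl

lemma emb_mp {E : Type} [MeasurableSpace E] (μ : Measure E) [IsProbabilityMeasure μ] {k n : ℕ}
    (g : Fin k ↪ Fin n) :
    MeasurePreserving (fun w : Fin n → E => (fun i => w (g i) : Fin k → E))
      (Measure.pi fun _ : Fin n => μ) (Measure.pi fun _ : Fin k => μ) :=
  measurePreserving_fst.comp (split_mp μ g)

lemma prob_Good (a r : ℝ) (μ : Measure (ℂ × ℝ)) [IsProbabilityMeasure μ] {k n : ℕ}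
    (T : Fin k → Fin k → Prop) (g : Fin k ↪ Fin n) :
    (Measure.pi fun _ : Fin n => μ) {w | Good a r T g w} =
      ∫⁻ v, ({v | Iso a r T v} : Set (Fin k → ℂ × ℝ)).indicator
        (fun v => (μ {e | e.1 ∉ SecU a r v}) ^ (n - k)) v ∂(Measure.pi fun _ : Fin k => μ) := by
  classical
  set S : Set ((Fin k → ℂ × ℝ) × ({j // ¬ (j ∈ Set.range g)} → ℂ × ℝ)) :=
    {p | Iso a r T p.1 ∧ ∀ j, (p.2 j).1 ∉ SecU a r p.1} with hS
  have hSm : MeasurableSet S := by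
    refine MeasurableSet.inter (measurable_fst (measurableSet_Iso a r T)) ?_
    change MeasurableSet {p : (Fin k → ℂ × ℝ) × ({j // ¬ (j ∈ Set.range g)} → ℂ × ℝ) |
      ∀ j, (p.2 j).1 ∉ SecU a r p.1}
    rw [Set.ofPred_forall]
    refine MeasurableSet.iInter fun j => ?_
    have h : Measurable (fun p : (Fin k → ℂ × ℝ) × ({j // ¬ (j ∈ Set.range g)} → ℂ × ℝ) =>
      (p.1, (p.2 j).1)) := by fun_prop
    exact h (measurableSet_SecU_rel a r).compl
  have hpre : {w | Good a r T g w} = (fun w : Fin n → ℂ × ℝ => ((fun i => w (g i) : Fin k → ℂ × ℝ),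
        (fun j => w j : {j // ¬ (j ∈ Set.range g)} → ℂ × ℝ))) ⁻¹' S := by
    ext w
    simp [Good, hS]
  rw [hpre, (split_mp μ g).measure_preimage hSm.nullMeasurableSet, Measure.prod_apply hSm]
  refine lintegral_congr fun v => ?_
  by_cases hv : Iso a r T v
  · rw [Set.indicator_of_mem (show v ∈ {v | Iso a r T v} from hv)]
    have : Prod.mk v ⁻¹' S = Set.univ.pi (fun _ => {e | e.1 ∉ SecU a r v}) := by
      ext u; simp [hS, hv, Set.mem_pi]
    rw [this, Measure.pi_pi, Finset.prod_const, Finset.card_univ, Fintype.card_subtype_compl]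
    congr 1
    rw [Fintype.card_fin, ← Fintype.card_congr (Equiv.ofInjective g g.injective), Fintype.card_fin]
  · rw [Set.indicator_of_notMem (show v ∉ {v | Iso a r T v} from hv)]
    have : Prod.mk v ⁻¹' S = ∅ := by
      ext u; simp [hS, hv]
    rw [this, measure_empty]

lemma integral_FH (a r : ℝ) (μ : Measure (ℂ × ℝ)) [IsProbabilityMeasure μ] {d n : ℕ}
    (T : Fin (d + 1) → Fin (d + 1) → Prop) :
    ∫ w, FH a r T w ∂(Measure.pi fun _ : Fin n => μ) = n.descFactorial (d + 1) *
      (∫⁻ v, ({v | Iso a r T v} : Set (Fin (d + 1) → ℂ × ℝ)).indicator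
        (fun v => (μ {e | e.1 ∉ SecU a r v}) ^ (n - (d + 1))) v
          ∂(Measure.pi fun _ : Fin (d + 1) => μ)).toReal := by
  classical
  have e1 : ∀ w : Fin n → ℂ × ℝ, FH a r T w =
      ∑ g : Fin (d + 1) ↪ Fin n, ({w | Good a r T g w} : Set _).indicator (fun _ => (1:ℝ)) w := by
    intro w
    rw [FH, Finset.card_filter]
    push_cast
    refine Finset.sum_congr rfl fun g _ => ?_
    simp [Set.indicator_apply]
  simp_rw [e1]
  rw [integral_finsetSum]
  · have e2 : ∀ g : Fin (d + 1) ↪ Fin n, ∫ w, ({w | Good a r T g w} : Set _).indicator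
        (fun _ => (1:ℝ)) w ∂(Measure.pi fun _ : Fin n => μ) = (∫⁻ v, ({v | Iso a r T v} : Set (Fin (d + 1) → ℂ × ℝ)).indicator
        (fun v => (μ {e | e.1 ∉ SecU a r v}) ^ (n - (d + 1))) v
          ∂(Measure.pi fun _ : Fin (d + 1) => μ)).toReal := by
      intro g
      rw [integral_indicator_const _ (measurableSet_Good a r T g), ← prob_Good a r μ T g]
      simp [Measure.real]
    rw [Finset.sum_congr rfl fun g _ => e2 g, Finset.sum_const, Finset.card_univ,
      Fintype.card_embedding_eq, Fintype.card_fin, Fintype.card_fin, nsmul_eq_mul]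
  · intro g _
    exact (integrable_const _).indicator (measurableSet_Good a r T g)

lemma near_prob (μ : Measure (ℂ × ℝ)) [IsProbabilityMeasure μ] (ρ : ℝ) (B : ENNReal)
    (hB : ∀ p : ℂ, μ {e | ‖e.1 - p‖ ≤ ρ} ≤ B) (m : ℕ) :
    (Measure.pi fun _ : Fin (m + 1) => μ) {v | ∀ i, ‖(v i).1 - (v 0).1‖ ≤ ρ} ≤ B ^ m := by
  have hm : MeasurableSet {v : Fin (m + 1) → ℂ × ℝ | ∀ i, ‖(v i).1 - (v 0).1‖ ≤ ρ} := by
    rw [Set.ofPred_forall]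
    exact MeasurableSet.iInter fun i => measurableSet_le (by fun_prop) (by fun_prop)
  have hmp := (measurePreserving_piFinSuccAbove (fun _ : Fin (m + 1) => μ) 0).symm
  rw [← hmp.measure_preimage hm.nullMeasurableSet, Measure.prod_apply (hmp.measurable hm)]
  have : ∀ e : ℂ × ℝ, (Measure.pi fun _ : Fin m => μ)
      (Prod.mk e ⁻¹' ((MeasurableEquiv.piFinSuccAbove (fun _ : Fin (m + 1) => ℂ × ℝ) 0).symm ⁻¹'
        {v : Fin (m + 1) → ℂ × ℝ | ∀ i, ‖(v i).1 - (v 0).1‖ ≤ ρ})) ≤ B ^ m := by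
    intro e
    have hsub : (Prod.mk e ⁻¹' ((MeasurableEquiv.piFinSuccAbove (fun _ : Fin (m + 1) => ℂ × ℝ) 0).symm ⁻¹'
        {v : Fin (m + 1) → ℂ × ℝ | ∀ i, ‖(v i).1 - (v 0).1‖ ≤ ρ})) ⊆
        Set.univ.pi (fun _ => {e' | ‖e'.1 - e.1‖ ≤ ρ}) := by
      intro u hu
      simp only [Set.mem_preimage, piFinSucc_symm, Set.mem_ofPred_eq] at hu
      intro i _
      have := hu i.succ
      simpa using this
    refine (measure_mono hsub).trans ?_
    rw [Measure.pi_pi, Finset.prod_const, Finset.card_univ, Fintype.card_fin]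
    exact pow_le_pow_left' (hB _) _
  refine (lintegral_mono this).trans ?_
  simp

lemma bad_prob (μ : Measure (ℂ × ℝ)) [IsProbabilityMeasure μ] (ρ : ℝ) (B : ENNReal)
    (hB : ∀ p : ℂ, μ {e | ‖e.1 - p‖ ≤ ρ} ≤ B) (hρ : 0 ≤ ρ) (m K n : ℕ) :
    (K.descFactorial m : ENNReal) *
      (Measure.pi fun _ : Fin n => μ) {w | ∃ v, K < Dcnt ρ w v} ≤ n ^ (m + 1) * B ^ m := by
  classical
  set P := Measure.pi fun _ : Fin n => μ with hP
  set A : (Fin (m + 1) ↪ Fin n) → Set (Fin n → ℂ × ℝ) := fun J =>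
    {w | ∀ i, ‖(w (J i)).1 - (w (J 0)).1‖ ≤ ρ} with hA
  have hAm : ∀ J, MeasurableSet (A J) := by
    intro J
    simp only [hA]
    rw [Set.ofPred_forall]
    exact MeasurableSet.iInter fun i => measurableSet_le (by fun_prop) (by fun_prop)
  set Gm : (Fin n → ℂ × ℝ) → ENNReal := fun w => ∑ J, (A J).indicator 1 w with hGm
  have hGmm : Measurable Gm := by
    refine Finset.measurable_sum _ fun J _ => measurable_one.indicator (hAm J)
  have hlow : {w | ∃ v, K < Dcnt ρ w v} ⊆ {w | (K.descFactorial m : ENNReal) ≤ Gm w} := by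
    rintro w ⟨v, hv⟩
    rw [Set.mem_ofPred_eq]
    have e1 : Gm w = ((Finset.univ.filter fun J => w ∈ A J).card : ENNReal) := by
      rw [hGm, Finset.card_filter]
      push_cast
      refine Finset.sum_congr rfl fun g _ => ?_
      simp [Set.indicator_apply]
    rw [e1]
    norm_cast
    set N := (Finset.univ.filter fun j => ‖(w j).1 - (w v).1‖ ≤ ρ).erase v with hN
    have hNc : K ≤ N.card := by
      rw [hN, Finset.card_erase_of_mem]
      · exact Nat.le_sub_one_of_lt hv
      · simp [hρ]
    have h1 : K.descFactorial m ≤ Fintype.card (Fin m ↪ N) := by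
      rw [Fintype.card_embedding_eq, Fintype.card_fin, Fintype.card_coe]
      exact Nat.descFactorial_le _ hNc
    refine h1.trans ?_
    rw [← Finset.card_univ]
    have hcinj : ∀ h : Fin m ↪ N, Function.Injective
        (Fin.cons v (fun i => (h i : Fin n)) : Fin (m + 1) → Fin n) := by
      intro h
      rw [Fin.cons_injective_iff]
      refine ⟨?_, fun i j hij => h.injective (Subtype.ext hij)⟩
      rintro ⟨i, hi⟩
      exact (Finset.mem_erase.1 (h i).2).1 hi
    refine Finset.card_le_card_of_injOn (fun h => ⟨_, hcinj h⟩) ?_ ?_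
    · intro h _
      simp only [Finset.coe_filter, Finset.mem_univ, true_and, Set.mem_ofPred_eq, hA,
        Function.Embedding.coeFn_mk, Fin.cons_zero]
      intro i
      refine Fin.cases ?_ (fun i => ?_) i
      · simp [hρ]
      · simp only [Fin.cons_succ]
        exact (Finset.mem_filter.1 (Finset.mem_erase.1 (h i).2).2).2
    · intro h _ h' _ heq
      ext i : 1
      have := DFunLike.congr_fun heq i.succ
      exact Subtype.ext this
  calc (K.descFactorial m : ENNReal) * P {w | ∃ v, K < Dcnt ρ w v}
      ≤ (K.descFactorial m : ENNReal) * P {w | (K.descFactorial m : ENNReal) ≤ Gm w} := by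
        gcongr
    _ ≤ ∫⁻ w, Gm w ∂P := mul_meas_ge_le_lintegral hGmm _
    _ = ∑ J, P (A J) := by
        rw [hGm, lintegral_finsetSum]
        · refine Finset.sum_congr rfl fun J _ => lintegral_indicator_one (hAm J)
        · exact fun J _ => measurable_one.indicator (hAm J)
    _ ≤ ∑ J : Fin (m + 1) ↪ Fin n, B ^ m := by
        refine Finset.sum_le_sum fun J _ => ?_
        have hm : MeasurableSet {v : Fin (m + 1) → ℂ × ℝ | ∀ i, ‖(v i).1 - (v 0).1‖ ≤ ρ} := by
          rw [Set.ofPred_forall]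
          exact MeasurableSet.iInter fun i => measurableSet_le (by fun_prop) (by fun_prop)
        have := (emb_mp μ J).measure_preimage hm.nullMeasurableSet
        refine le_trans (le_of_eq ?_) (near_prob μ ρ B hB m)
        rw [← this]; rfl
    _ = (n.descFactorial (m + 1) : ENNReal) * B ^ m := by
        rw [Finset.sum_const, Finset.card_univ,
          Fintype.card_embedding_eq, Fintype.card_fin, Fintype.card_fin, nsmul_eq_mul]
    _ ≤ _ := by
        gcongr
        exact_mod_cast Nat.descFactorial_le_pow n (m + 1)

lemma lint_pi {E : Type} [MeasurableSpace E] (μ : Measure E) [SigmaFinite μ] :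
    ∀ (d : ℕ) (g : Fin d → E → ENNReal), (∀ i, Measurable (g i)) →
    ∫⁻ x, ∏ i, g i (x i) ∂(Measure.pi fun _ : Fin d => μ) = ∏ i, ∫⁻ x, g i x ∂μ := by
  intro d
  induction d with
  | zero => intro g hg; simp
  | succ d ih =>
    intro g hg
    have h := (measurePreserving_piFinSuccAbove (fun _ : Fin (d+1) => μ) 0).symm
    rw [← h.lintegral_comp_emb (MeasurableEquiv.measurableEmbedding _)]
    simp only [piFinSucc_symm, Fin.prod_univ_succ, Fin.cons_zero, Fin.cons_succ]
    rw [← ih (fun i => g i.succ) (fun i => hg _)]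
    exact lintegral_prod_mul (μ := μ) (ν := Measure.pi fun _ : Fin d => μ) (f := g 0) (g := fun x : Fin d → E => ∏ i, g i.succ (x i)) (hg 0).aemeasurable
      (Finset.measurable_fun_prod _ (fun i _ => (hg _).comp (measurable_pi_apply i))).aemeasurable

lemma pi_withDens {E : Type} [MeasurableSpace E] (μ : Measure E) [SigmaFinite μ]
    (f : E → ENNReal) (hf : Measurable f) [SigmaFinite (μ.withDensity f)] (d : ℕ) :
    Measure.pi (fun _ : Fin d => μ.withDensity f) =
      (Measure.pi (fun _ : Fin d => μ)).withDensity (fun x => ∏ i, f (x i)) := by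
  refine Measure.pi_eq (fun s hs => ?_)
  rw [withDensity_apply _ (MeasurableSet.univ_pi hs), ← lintegral_indicator (MeasurableSet.univ_pi hs)]
  have : (univ.pi s).indicator (fun x : Fin d → E => ∏ i, f (x i)) =
      fun x => ∏ i, (s i).indicator f (x i) := by
    funext x
    by_cases hx : x ∈ univ.pi s
    · rw [indicator_of_mem hx]
      exact Finset.prod_congr rfl (fun i _ => (indicator_of_mem (hx i trivial) f).symm)
    · rw [indicator_of_notMem hx]
      simp only [Set.mem_pi, Set.mem_univ, true_implies, not_forall] at hx
      obtain ⟨i, hi⟩ := hx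
      exact (Finset.prod_eq_zero (Finset.mem_univ i) (indicator_of_notMem hi f)).symm
  rw [this, lint_pi μ d (fun i => (s i).indicator f) (fun i => hf.indicator (hs i))]
  refine Finset.prod_congr rfl (fun i _ => ?_)
  rw [withDensity_apply _ (hs i), lintegral_indicator (hs i)]

lemma lint_scale (d : ℕ) (r : ℝ) (hr : 0 < r) (x : Fin d → ℂ) (G : (Fin d → ℂ) → ENNReal)
    (hG : Measurable G) :
    ∫⁻ z, G z = ENNReal.ofReal (r^(2*d)) * ∫⁻ z : Fin d → ℂ, G (fun i => x i + r * z i) := by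
  have h1 : ∫⁻ z : Fin d → ℂ, G (fun i => x i + r * z i) = ∫⁻ z, (fun z => G (x + z)) z ∂(Measure.map (fun z => r • z) (volume : Measure (Fin d → ℂ))) := by
    rw [lintegral_map (by fun_prop) (by fun_prop)]
    rfl
  rw [h1, Measure.map_addHaar_smul _ hr.ne', lintegral_smul_measure]
  have h2 : Module.finrank ℝ (Fin d → ℂ) = 2*d := by
    rw [Module.finrank_pi_fintype]; simp [Complex.finrank_real_complex, mul_comm]
  rw [h2, lintegral_add_left_eq_self (μ := volume) G x, smul_eq_mul, ← mul_assoc, ← ENNReal.ofReal_mul (by positivity),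
    abs_of_pos (by positivity), mul_inv_cancel₀ (by positivity)]
  simp

lemma pts_eq (d : ℕ) (z : Fin d → ℂ) : pts (k := d+1) z = (Fin.cons 0 z : Fin (d+1) → ℂ) := by
  funext i
  refine Fin.cases ?_ (fun j => ?_) i
  · simp [pts]
  · simp [pts]

lemma lint_scale1 (r : ℝ) (hr : 0 < r) (x : ℂ) (G : ℂ → ENNReal)
    (hG : Measurable G) :
    ∫⁻ z, G z = ENNReal.ofReal (r^2) * ∫⁻ z, G (x + r * z) := by
  have h1 : ∫⁻ z, G (x + r * z) = ∫⁻ z, (fun z => G (x + z)) z ∂(Measure.map (fun z => r • z) (volume : Measure ℂ)) := by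
    rw [lintegral_map (by fun_prop) (by fun_prop)]
    simp
  rw [h1, Measure.map_addHaar_smul _ hr.ne', lintegral_smul_measure]
  rw [Complex.finrank_real_complex, lintegral_add_left_eq_self (μ := volume) G x, smul_eq_mul, ← mul_assoc, ← ENNReal.ofReal_mul (by positivity),
    abs_of_pos (by positivity), mul_inv_cancel₀ (by positivity)]
  simp

def VV {d : ℕ} (z : Fin d → ℂ) (y : Fin (d+1) → ℝ) (i : Fin (d+1)) : ℂ × ℝ := (pts (k := d+1) z i, y i)

lemma measurable_VV {d : ℕ} : Measurable (fun p : (Fin d → ℂ) × (Fin (d+1) → ℝ) => VV p.1 p.2) := by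
  refine measurable_pi_lambda _ (fun i => ?_)
  unfold VV
  refine Measurable.prodMk ?_ (by fun_prop)
  simp only [pts_eq]
  refine Fin.cases ?_ (fun j => ?_) i
  · simp
  · simp only [Fin.cons_succ]; fun_prop

lemma cv {d : ℕ} (f : ℂ → ℝ) (hf : Measurable f) 
    (U : Measure ℝ) [IsProbabilityMeasure U]
    [SigmaFinite (volume.withDensity fun x : ℂ => ENNReal.ofReal (f x))]
    (r : ℝ) (hr : 0 < r) (Φ : (Fin (d+1) → ℂ × ℝ) → ENNReal) (hΦ : Measurable Φ) :
    ∫⁻ v, Φ v ∂(Measure.pi fun _ : Fin (d+1) => (volume.withDensity fun x : ℂ => ENNReal.ofReal (f x)).prod U)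
     = ENNReal.ofReal (r^(2*d)) * ∫⁻ q : ℂ × ((Fin d → ℂ) × (Fin (d+1) → ℝ)),
       ENNReal.ofReal (f q.1) * (∏ i, ENNReal.ofReal (f (q.1 + r * q.2.1 i))) *
         Φ (fun i => (q.1 + r * (VV q.2.1 q.2.2 i).1, (VV q.2.1 q.2.2 i).2))
         ∂(volume.prod (volume.prod (Measure.pi fun _ => U))) := by
  set ν := volume.withDensity fun x : ℂ => ENNReal.ofReal (f x) with hν
  have hm := measurePreserving_arrowProdEquivProdArrow ℂ ℝ (Fin (d+1)) (fun _ => ν) (fun _ => U)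
  rw [← hm.symm.lintegral_comp_emb (MeasurableEquiv.measurableEmbedding _)]
  have e1 : ∀ p : (Fin (d+1) → ℂ) × (Fin (d+1) → ℝ), (MeasurableEquiv.arrowProdEquivProdArrow ℂ ℝ (Fin (d+1))).symm p = fun i => (p.1 i, p.2 i) := fun p => rfl
  simp only [e1]
  have mm : Measurable (fun p : (Fin (d+1) → ℂ) × (Fin (d+1) → ℝ) => Φ (fun i => (p.1 i, p.2 i))) := 
    hΦ.comp (by fun_prop)
  rw [lintegral_prod _ mm.aemeasurable]
  have h := (measurePreserving_piFinSuccAbove (fun _ : Fin (d+1) => ν) 0).symm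
  rw [← h.lintegral_comp_emb (MeasurableEquiv.measurableEmbedding _)]
  simp only [piFinSucc_symm]
  have mc : Measurable (fun p : ℂ × (Fin d → ℂ) => (Fin.cons p.1 p.2 : Fin (d+1) → ℂ)) := by
    refine measurable_pi_lambda _ (fun i => ?_)
    refine Fin.cases ?_ (fun j => ?_) i
    · simp; fun_prop
    · simp only [Fin.cons_succ]; fun_prop
  have mH : Measurable (fun p : ℂ × (Fin d → ℂ) => ∫⁻ y, Φ (fun i => ((Fin.cons p.1 p.2 : Fin (d+1) → ℂ) i, y i)) ∂(Measure.pi fun _ => U)) := by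
    exact (mm.lintegral_prod_right').comp mc
  have mf : Measurable fun x : ℂ => ENNReal.ofReal (f x) := by fun_prop
  have mpf : Measurable fun x : Fin d → ℂ => ∏ i, ENNReal.ofReal (f (x i)) := by fun_prop
  erw [lintegral_prod _ mH.aemeasurable]
  have mV := measurable_VV (d := d)
  have mV' : ∀ i, Measurable fun q : ℂ × ((Fin d → ℂ) × (Fin (d+1) → ℝ)) => VV q.2.1 q.2.2 i := fun i =>
    (measurable_pi_apply i).comp (mV.comp measurable_snd)
  have mI : Measurable fun q : ℂ × ((Fin d → ℂ) × (Fin (d+1) → ℝ)) => ENNReal.ofReal (f q.1) * (∏ i, ENNReal.ofReal (f (q.1 + r * q.2.1 i))) *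
         Φ (fun i => (q.1 + r * (VV q.2.1 q.2.2 i).1, (VV q.2.1 q.2.2 i).2)) := by
    refine Measurable.mul ?_ (hΦ.comp (measurable_pi_lambda _ (fun i => ?_)))
    · fun_prop
    · exact (measurable_fst.add ((mV' i).fst.const_mul _)).prodMk (mV' i).snd
  rw [lintegral_prod _ mI.aemeasurable]
  rw [hν, lintegral_withDensity_eq_lintegral_mul _ mf (mH.lintegral_prod_right'), ← hν, ← lintegral_const_mul' _ _ ENNReal.ofReal_ne_top]
  refine lintegral_congr (fun x => ?_)
  simp only [Pi.mul_apply]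
  rw [lintegral_prod _ (by exact (mI.comp (measurable_prodMk_left)).aemeasurable)]
  have mHx : Measurable (fun z : Fin d → ℂ => ∫⁻ y, Φ (fun i => ((Fin.cons x z : Fin (d+1) → ℂ) i, y i)) ∂(Measure.pi fun _ => U)) := mH.comp measurable_prodMk_left
  rw [pi_withDens volume _ mf, lintegral_withDensity_eq_lintegral_mul _ mpf mHx]
  rw [show (Measure.pi fun _ : Fin d => (volume : Measure ℂ)) = volume from rfl]
  rw [lint_scale d r hr (fun _ => x) _ (mpf.mul mHx), mul_left_comm, ← lintegral_const_mul' _ _ ENNReal.ofReal_ne_top]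
  congr 1
  refine lintegral_congr (fun z => ?_)
  simp only [Pi.mul_apply]
  have hne : ENNReal.ofReal (f x) * (∏ i, ENNReal.ofReal (f (x + r * z i))) ≠ ⊤ := 
    ENNReal.mul_ne_top ENNReal.ofReal_ne_top (ENNReal.prod_ne_top (fun i _ => ENNReal.ofReal_ne_top))
  rw [lintegral_const_mul' _ _ hne, mul_assoc]
  congr 2
  refine lintegral_congr (fun y => ?_)
  congr 1
  funext i
  simp only [VV, pts_eq]
  refine Fin.cases ?_ (fun j => ?_) i <;> simp

def U0 : Measure ℝ := (ENNReal.ofReal (2 * π))⁻¹ • volume.restrict (Set.Ico 0 (2 * π))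

instance : IsProbabilityMeasure U0 := by
  constructor
  unfold U0
  have : 0 < 2 * π := by positivity
  rw [Measure.smul_apply, Measure.restrict_apply_univ, Real.volume_Ico, sub_zero, smul_eq_mul]
  exact ENNReal.inv_mul_cancel (by simp [Real.pi_pos]) ENNReal.ofReal_ne_top

lemma pi_U0 (d : ℕ) : (Measure.pi fun _ : Fin d => U0) =
    ((ENNReal.ofReal (2 * π))⁻¹)^d • volume.restrict (Set.univ.pi (fun _ : Fin d => Set.Ico 0 (2 * π))) := by
  refine Measure.pi_eq (fun s hs => ?_)
  rw [volume_pi, Measure.restrict_pi_pi, Measure.smul_apply, Measure.pi_pi, smul_eq_mul]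
  simp only [U0, Measure.smul_apply, smul_eq_mul, Finset.prod_mul_distrib, Finset.prod_const, Finset.card_univ, Fintype.card_fin]

lemma integral_pi_U0 (d : ℕ) (G : (Fin d → ℝ) → ℝ) : ∫ y, G y ∂(Measure.pi fun _ : Fin d => U0) =
    ((2*π)^d)⁻¹ * ∫ y in Set.univ.pi (fun _ : Fin d => Set.Ico 0 (2 * π)), G y := by
  have : 0 ≤ 2 * π := by positivity
  rw [pi_U0, integral_smul_measure, smul_eq_mul]
  rw [ENNReal.toReal_pow, ENNReal.toReal_inv, ENNReal.toReal_ofReal this, inv_pow]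

lemma SecU_fin {k : ℕ} (a : ℝ) (v : Fin k → ℂ × ℝ) : volume (SecU a 1 v) < ⊤ := by
  have : SecU a 1 v ⊆ ⋃ i, Metric.closedBall (v i).1 1 := by
    intro z hz
    obtain ⟨i, hi⟩ := SecU_bound hz
    exact mem_iUnion.2 ⟨i, by simpa [dist_eq_norm] using hi⟩
  refine lt_of_le_of_lt (measure_mono this) ?_
  refine lt_of_le_of_lt (measure_iUnion_fintype_le _ _) ?_
  exact ENNReal.sum_lt_top.2 (fun i _ => measure_closedBall_lt_top)

/-- the mass function -/
def pm (f : ℂ → ℝ) {k : ℕ} (a r : ℝ) (x : ℂ) (v : Fin k → ℂ × ℝ) : ℝ :=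
  r^2 * ∫ u in SecU a 1 v, f (x + r * u)

lemma pm_eq (f : ℂ → ℝ) (hf : Measurable f) (hf0 : ∀ x, 0 ≤ f x) {k : ℕ} (a r : ℝ) (hr : 0 < r) (x : ℂ)
    (v : Fin k → ℂ × ℝ) :
    (volume.withDensity fun x : ℂ => ENNReal.ofReal (f x)).real
      (SecU a r (fun i => (x + r * (v i).1, (v i).2))) = pm f a r x v := by
  have mf : Measurable fun x : ℂ => ENNReal.ofReal (f x) := by fun_prop
  have mS := measurableSet_SecU a r (fun i => (x + r * (v i).1, (v i).2))
  rw [Measure.real, withDensity_apply _ mS, ← lintegral_indicator mS,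
    lint_scale1 r hr x _ (mf.indicator mS), pm, ENNReal.toReal_mul, ENNReal.toReal_ofReal (by positivity)]
  rw [integral_eq_lintegral_of_nonneg_ae (Eventually.of_forall (fun u => hf0 _))
    (hf.comp (by fun_prop : Measurable fun u : ℂ => x + r * u)).aestronglyMeasurable,
    ← lintegral_indicator (measurableSet_SecU a 1 v)]
  congr 2
  refine lintegral_congr (fun z => ?_)
  by_cases hz : z ∈ SecU a 1 v
  · rw [indicator_of_mem hz, indicator_of_mem ((SecU_scale a hr x z v).2 hz)]
  · rw [indicator_of_notMem hz, indicator_of_notMem (fun h => hz ((SecU_scale a hr x z v).1 h))]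

lemma compl_mass (ν : Measure ℂ) [IsProbabilityMeasure ν] (S : Set ℂ) (hS : MeasurableSet S) :
    (ν.prod U0) {e | e.1 ∉ S} = ENNReal.ofReal (1 - ν.real S) := by
  have h : {e : ℂ × ℝ | e.1 ∉ S} = Sᶜ ×ˢ (univ : Set ℝ) := by ext e; simp
  rw [h, Measure.prod_prod, measure_univ, mul_one, ← probReal_compl_eq_one_sub hS, ofReal_measureReal]

def Psi (f : ℂ → ℝ) {d : ℕ} (a r : ℝ) (T : Fin (d+1) → Fin (d+1) → Prop) (m : ℕ) 
    (q : ℂ × ((Fin d → ℂ) × (Fin (d+1) → ℝ))) : ℝ :=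
  f q.1 * (∏ i, f (q.1 + r * q.2.1 i)) *
    ({v | Iso a 1 T v} : Set _).indicator (fun v => (1 - pm f a r q.1 v)^m) (VV q.2.1 q.2.2)

def QQ (d : ℕ) : Measure (ℂ × ((Fin d → ℂ) × (Fin (d+1) → ℝ))) :=
  volume.prod (volume.prod (Measure.pi fun _ => U0))

lemma Psi_main (f : ℂ → ℝ) (hf : Measurable f) (hf0 : ∀ x, 0 ≤ f x) {d : ℕ} (a r : ℝ) (hr : 0 < r)
    (T : Fin (d+1) → Fin (d+1) → Prop) (m : ℕ)
    [IsProbabilityMeasure (volume.withDensity fun x : ℂ => ENNReal.ofReal (f x))] :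
    Measurable (Psi f a r T m) ∧ 
    (∫⁻ v, ({v | Iso a r T v}).indicator (fun v => 
      (((volume.withDensity fun x : ℂ => ENNReal.ofReal (f x)).prod U0) {e | e.1 ∉ SecU a r v})^m) v 
        ∂(Measure.pi fun _ : Fin (d+1) => (volume.withDensity fun x : ℂ => ENNReal.ofReal (f x)).prod U0)).toReal
      = r^(2*d) * ∫ q, Psi f a r T m q ∂(QQ d) := by
  set ν := volume.withDensity fun x : ℂ => ENNReal.ofReal (f x) with hν
  set Φ : (Fin (d+1) → ℂ × ℝ) → ENNReal := ({v | Iso a r T v}).indicator (fun v => 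
      ((ν.prod U0) {e | e.1 ∉ SecU a r v})^m) with hΦ
  have mΦ : Measurable Φ := by
    refine Measurable.indicator ?_ (measurableSet_Iso a r T)
    refine Measurable.pow_const ?_ m
    have hS : MeasurableSet {p : (Fin (d+1) → ℂ × ℝ) × (ℂ × ℝ) | p.2.1 ∉ SecU a r p.1} :=
      (show Measurable fun p : (Fin (d+1) → ℂ × ℝ) × (ℂ × ℝ) => (p.1, p.2.1) by fun_prop)
        (measurableSet_SecU_rel a r).compl
    exact measurable_measure_prodMk_left hS
  have hcv := cv f hf U0 r hr Φ mΦ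
  have mV' : ∀ i, Measurable fun q : ℂ × ((Fin d → ℂ) × (Fin (d+1) → ℝ)) => VV q.2.1 q.2.2 i := fun i =>
    (measurable_pi_apply i).comp (measurable_VV.comp measurable_snd)
  set I : ℂ × ((Fin d → ℂ) × (Fin (d+1) → ℝ)) → ENNReal := fun q => ENNReal.ofReal (f q.1) * (∏ i, ENNReal.ofReal (f (q.1 + r * q.2.1 i))) *
         Φ (fun i => (q.1 + r * (VV q.2.1 q.2.2 i).1, (VV q.2.1 q.2.2 i).2)) with hI
  have mI : Measurable I := by
    refine Measurable.mul ?_ (mΦ.comp (measurable_pi_lambda _ (fun i => ?_)))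
    · fun_prop
    · exact (measurable_fst.add ((mV' i).fst.const_mul _)).prodMk (mV' i).snd
  have hIP : ∀ q, I q = ENNReal.ofReal (Psi f a r T m q) := by
    intro q
    simp only [hI, Psi, hΦ]
    rw [ENNReal.ofReal_mul (mul_nonneg (hf0 _) (Finset.prod_nonneg (fun i _ => hf0 _))),
      ENNReal.ofReal_mul (hf0 _), ENNReal.ofReal_prod_of_nonneg (fun i _ => hf0 _)]
    congr 1
    by_cases h : Iso a 1 T (VV q.2.1 q.2.2)
    · rw [indicator_of_mem (by exact (Iso_scale a hr T q.1 _).2 h), indicator_of_mem (by exact h),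
        compl_mass _ _ (measurableSet_SecU _ _ _), pm_eq f hf hf0 a r hr, ENNReal.ofReal_pow]
      rw [← pm_eq f hf hf0 a r hr]
      simp [measureReal_le_one]
    · rw [indicator_of_notMem (by exact fun h' => h ((Iso_scale a hr T q.1 _).1 h')), indicator_of_notMem (by exact h)]
      simp
  have hP0 : ∀ q, 0 ≤ Psi f a r T m q := by
    intro q
    refine mul_nonneg (mul_nonneg (hf0 _) (Finset.prod_nonneg (fun i _ => hf0 _))) ?_
    refine indicator_nonneg (fun v _ => ?_) _
    rw [← pm_eq f hf hf0 a r hr]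
    exact pow_nonneg (by simp [measureReal_le_one]) _
  have hPI : Psi f a r T m = fun q => (I q).toReal := by
    funext q
    rw [hIP, ENNReal.toReal_ofReal (hP0 q)]
  refine ⟨by rw [hPI]; exact mI.ennreal_toReal, ?_⟩
  rw [hcv, ENNReal.toReal_mul, ENNReal.toReal_ofReal (by positivity), hPI, integral_toReal mI.aemeasurable]
  · rfl
  · exact Eventually.of_forall (fun q => by rw [hIP]; exact ENNReal.ofReal_lt_top)

lemma Psi_bd (f : ℂ → ℝ) (hf : Measurable f) (hf0 : ∀ x, 0 ≤ f x) (C : ℝ) (hC : ∀ x, f x ≤ C) {d : ℕ} (a r : ℝ) (hr : 0 < r)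
    (T : Fin (d+1) → Fin (d+1) → Prop) (hT : (SimpleGraph.fromRel T).Connected) (m : ℕ)
    [IsProbabilityMeasure (volume.withDensity fun x : ℂ => ENNReal.ofReal (f x))] (q) :
    ‖Psi f a r T m q‖ ≤ (C^d * f q.1) * ((Metric.closedBall (0 : Fin d → ℂ) (d+1)).indicator (fun _ => 1) q.2.1 * 1) := by
  have hC0 : 0 ≤ C := (hf0 0).trans (hC 0)
  by_cases h : Iso a 1 T (VV q.2.1 q.2.2)
  · have hz : q.2.1 ∈ Metric.closedBall (0 : Fin d → ℂ) (d+1) := by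
      rw [mem_closedBall_zero_iff, pi_norm_le_iff_of_nonneg (by positivity)]
      intro i
      have := Iso_bound (zero_le_one) hT h i.succ 0
      simpa [VV, pts_eq] using this
    rw [indicator_of_mem hz, Psi, indicator_of_mem (by exact h), Real.norm_eq_abs, abs_of_nonneg, mul_comm (C^d)]
    · rw [mul_one]
      refine mul_le_mul ?_ ?_ ?_ ?_
      · refine mul_le_mul_of_nonneg_left ?_ (hf0 _)
        calc _ ≤ ∏ i : Fin d, C := Finset.prod_le_prod (fun i _ => hf0 _) (fun i _ => hC _)
          _ = C^d := by simp
      · rw [← pm_eq f hf hf0 a r hr]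
        exact pow_le_one₀ (by simp [measureReal_le_one]) (by simp)
      · rw [← pm_eq f hf hf0 a r hr]
        exact pow_nonneg (by simp [measureReal_le_one]) _
      · exact mul_nonneg (hf0 _) (by positivity)
    · refine mul_nonneg (mul_nonneg (hf0 _) (Finset.prod_nonneg (fun i _ => hf0 _))) ?_
      rw [← pm_eq f hf hf0 a r hr]
      exact pow_nonneg (by simp [measureReal_le_one]) _
  · rw [Psi, indicator_of_notMem (by exact h)]
    simp only [mul_zero, norm_zero, mul_one]
    exact mul_nonneg (mul_nonneg (by positivity) (hf0 _)) (indicator_nonneg (fun _ _ => by simp) _)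

lemma bd_int (f : ℂ → ℝ) (hfi : Integrable f) (C : ℝ) (d : ℕ) :
    Integrable (fun q : ℂ × ((Fin d → ℂ) × (Fin (d+1) → ℝ)) => (C^d * f q.1) * ((Metric.closedBall (0 : Fin d → ℂ) (d+1)).indicator (fun _ => (1:ℝ)) q.2.1 * 1)) (QQ d) := by
  refine Integrable.mul_prod (f := fun x => C^d * f x) (g := fun p : (Fin d → ℂ) × (Fin (d+1) → ℝ) => (Metric.closedBall (0 : Fin d → ℂ) (d+1)).indicator (fun _ => (1:ℝ)) p.1 * 1) (hfi.const_mul _) ?_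
  refine Integrable.mul_prod (f := fun z : Fin d → ℂ => (Metric.closedBall (0 : Fin d → ℂ) (d+1)).indicator (fun _ => (1:ℝ)) z) (g := fun _ => (1:ℝ)) ?_ (integrable_const _)
  rw [integrable_indicator_iff measurableSet_closedBall]
  exact integrableOn_const measure_closedBall_lt_top.ne

lemma pm_tendsto (f : ℂ → ℝ) (hf : Measurable f) (hf0 : ∀ x, 0 ≤ f x) (C : ℝ) (hC : ∀ x, f x ≤ C) {k : ℕ} (a : ℝ)
    (x : ℂ) (hx : ContinuousAt f x) (v : Fin k → ℂ × ℝ) (r : ℕ → ℝ) (hr0 : Tendsto r atTop (𝓝 0)) (L : ℝ)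
    (hr : Tendsto (fun n : ℕ => (n : ℝ) * r n ^ 2) atTop (𝓝 L)) :
    Tendsto (fun n : ℕ => (n:ℝ) * pm f a (r n) x v) atTop (𝓝 (L * f x * (volume (SecU a 1 v)).toReal)) := by
  have h1 : Tendsto (fun n : ℕ => ∫ u in SecU a 1 v, f (x + r n * u)) atTop (𝓝 (∫ u in SecU a 1 v, f x)) := by
    refine tendsto_integral_of_dominated_convergence (fun _ => C) 
      (fun n => (hf.comp (by fun_prop : Measurable fun u : ℂ => x + r n * u)).aestronglyMeasurable) ?_ ?_ ?_
    · exact integrableOn_const (SecU_fin a v).ne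
    · exact fun n => Eventually.of_forall (fun u => by rw [Real.norm_eq_abs, abs_of_nonneg (hf0 _)]; exact hC _)
    · refine Eventually.of_forall (fun u => ?_)
      have : Tendsto (fun n => x + (r n : ℂ) * u) atTop (𝓝 x) := by
        have h := ((Complex.continuous_ofReal.tendsto 0).comp hr0).mul_const u |>.const_add x
        simpa using h
      exact hx.tendsto.comp this
  have h2 := hr.mul h1
  simp only [integral_const, smul_eq_mul] at h2
  convert h2 using 2
  · unfold pm; ring
  · simp [Measure.real]; ring

lemma pow_tendsto (p : ℕ → ℝ) (t : ℝ) (h : Tendsto (fun n : ℕ => (n:ℝ) * p n) atTop (𝓝 t)) (k : ℕ) :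
    Tendsto (fun n : ℕ => (1 - p n)^(n - k)) atTop (𝓝 (Real.exp (-t))) := by
  have h1 : Tendsto (fun n : ℕ => (1 + (-p n))^n) atTop (𝓝 (Real.exp (-t))) := by
    refine Real.tendsto_one_add_pow_exp_of_tendsto ?_
    simpa using h.neg
  have hp : Tendsto p atTop (𝓝 0) := by
    have := h.mul (tendsto_inv_atTop_nhds_zero_nat (𝕜 := ℝ))
    rw [mul_zero] at this
    refine this.congr' ?_
    filter_upwards [eventually_gt_atTop 0] with n hn
    have : (n:ℝ) ≠ 0 := by positivity
    field_simp
  have h2 : Tendsto (fun n => (1 - p n)^k) atTop (𝓝 1) := by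
    simpa using (hp.const_sub 1).pow k
  have h3 := h1.div h2 one_ne_zero
  rw [div_one] at h3
  refine h3.congr' ?_
  have hp' : ∀ᶠ n in atTop, p n < 1 := hp.eventually_lt_const one_pos
  filter_upwards [hp', eventually_ge_atTop k] with n h4 h5
  have h6 : 1 - p n ≠ 0 := by linarith
  simp only [Pi.div_apply, ← sub_eq_add_neg]
  rw [div_eq_iff (pow_ne_zero _ h6), ← pow_add, Nat.sub_add_cancel h5]

def Psi0 (f : ℂ → ℝ) {d : ℕ} (a L : ℝ) (T : Fin (d+1) → Fin (d+1) → Prop) 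
    (q : ℂ × ((Fin d → ℂ) × (Fin (d+1) → ℝ))) : ℝ :=
  f q.1 * (f q.1)^d * (hInd a T (pts (k := d+1) q.2.1) q.2.2 * 
    Real.exp (-(L * f q.1) * sectorUnionVol a (pts (k := d+1) q.2.1) q.2.2))

lemma Psi_tendsto (f : ℂ → ℝ) (hf : Measurable f) (hf0 : ∀ x, 0 ≤ f x) (C : ℝ) (hC : ∀ x, f x ≤ C) {d : ℕ} (a : ℝ)
    (T : Fin (d+1) → Fin (d+1) → Prop) (q : ℂ × ((Fin d → ℂ) × (Fin (d+1) → ℝ)))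
    (hx : ContinuousAt f q.1) (r : ℕ → ℝ) (hr0 : Tendsto r atTop (𝓝 0)) (L : ℝ)
    (hr : Tendsto (fun n : ℕ => (n : ℝ) * r n ^ 2) atTop (𝓝 L)) (k : ℕ) :
    Tendsto (fun n : ℕ => Psi f a (r n) T (n - k) q) atTop (𝓝 (Psi0 f a L T q)) := by
  unfold Psi Psi0
  refine Tendsto.mul (Tendsto.mul tendsto_const_nhds ?_) ?_
  · have : (f q.1)^d = ∏ i : Fin d, f q.1 := by simp
    rw [this]
    refine tendsto_finsetProd _ (fun i _ => hx.tendsto.comp ?_)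
    have h := ((Complex.continuous_ofReal.tendsto 0).comp hr0).mul_const (q.2.1 i) |>.const_add q.1
    simpa using h
  · by_cases h : Iso a 1 T (VV q.2.1 q.2.2)
    · have h1 : hInd a T (pts (k := d+1) q.2.1) q.2.2 = 1 := if_pos h
      rw [h1, one_mul]
      have := pow_tendsto _ _ (pm_tendsto f hf hf0 C hC a q.1 hx (VV q.2.1 q.2.2) r hr0 L hr) k
      simp only [indicator_of_mem (show VV q.2.1 q.2.2 ∈ ({v | Iso a 1 T v} : Set (Fin (d+1) → ℂ × ℝ)) from h)]
      convert this using 2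
      congr 1
      unfold sectorUnionVol SecU VV
      ring
    · have h1 : hInd a T (pts (k := d+1) q.2.1) q.2.2 = 0 := if_neg h
      rw [h1, zero_mul]
      simp only [indicator_of_notMem (show VV q.2.1 q.2.2 ∉ ({v | Iso a 1 T v} : Set (Fin (d+1) → ℂ × ℝ)) from h)]
      exact tendsto_const_nhds

lemma r_tendsto (r : ℕ → ℝ) (hrpos : ∀ n, 0 < r n) (L : ℝ)
    (hr : Tendsto (fun n : ℕ => (n : ℝ) * r n ^ 2) atTop (𝓝 L)) : Tendsto r atTop (𝓝 0) := by
  have h1 : Tendsto (fun n => (r n)^2) atTop (𝓝 0) := by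
    have := hr.mul (tendsto_inv_atTop_nhds_zero_nat (𝕜 := ℝ))
    rw [mul_zero] at this
    refine this.congr' ?_
    filter_upwards [eventually_gt_atTop 0] with n hn
    have : (n:ℝ) ≠ 0 := by positivity
    field_simp
  have h2 := (Real.continuous_sqrt.tendsto 0).comp h1
  rw [Real.sqrt_zero] at h2
  refine h2.congr (fun n => ?_)
  simp [Real.sqrt_sq (hrpos n).le]

lemma descFac_tendsto (k : ℕ) : Tendsto (fun n : ℕ => (n.descFactorial k : ℝ) / (n:ℝ)^k) atTop (𝓝 1) := by
  induction k with
  | zero => simp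
  | succ k ih =>
    have h1 : Tendsto (fun n : ℕ => 1 - (k:ℝ) * (n:ℝ)⁻¹) atTop (𝓝 1) := by
      simpa using ((tendsto_inv_atTop_nhds_zero_nat (𝕜 := ℝ)).const_mul (k:ℝ)).const_sub 1
    have h2 := h1.mul ih
    rw [mul_one] at h2
    refine h2.congr' ?_
    filter_upwards [eventually_gt_atTop k] with n hn
    have : (n:ℝ) ≠ 0 := by have : 0 < n := by omega
                           positivity
    rw [Nat.descFactorial_succ, Nat.cast_mul, Nat.cast_sub hn.le]
    field_simp
    ring

lemma Psi0_int (f : ℂ → ℝ) (hf : Measurable f) (hf0 : ∀ x, 0 ≤ f x) (C : ℝ) (hC : ∀ x, f x ≤ C) 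
    (hfi : Integrable f) (hfc : ∀ᵐ x, ContinuousAt f x)
    {d : ℕ} (a : ℝ)
    (T : Fin (d+1) → Fin (d+1) → Prop) (hT : (SimpleGraph.fromRel T).Connected)
    [IsProbabilityMeasure (volume.withDensity fun x : ℂ => ENNReal.ofReal (f x))]
    (r : ℕ → ℝ) (hrpos : ∀ n, 0 < r n) (L : ℝ)
    (hr : Tendsto (fun n : ℕ => (n : ℝ) * r n ^ 2) atTop (𝓝 L)) :
    Integrable (Psi0 f a L T) (QQ d) ∧ Tendsto (fun n : ℕ => ∫ q, Psi f a (r n) T (n - (d+1)) q ∂(QQ d)) atTop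
      (𝓝 (∫ q, Psi0 f a L T q ∂(QQ d))) := by
  have hae : ∀ᵐ q ∂(QQ d), Tendsto (fun n : ℕ => Psi f a (r n) T (n - (d+1)) q) atTop (𝓝 (Psi0 f a L T q)) := by
    have : ∀ᵐ q ∂(QQ d), ContinuousAt f q.1 := Measure.quasiMeasurePreserving_fst.ae hfc
    filter_upwards [this] with q hq
    exact Psi_tendsto f hf hf0 C hC a T q hq r (r_tendsto r hrpos L hr) L hr _
  have hm : ∀ n, AEStronglyMeasurable (Psi f a (r n) T (n - (d+1))) (QQ d) := fun n =>
    (Psi_main f hf hf0 a (r n) (hrpos n) T (n - (d+1))).1.aestronglyMeasurable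
  have hb := bd_int f hfi C d
  have hbd : ∀ n, ∀ q, _ := fun n q => Psi_bd f hf hf0 C hC a (r n) (hrpos n) T hT (n - (d+1)) q
  constructor
  · refine hb.mono' (aestronglyMeasurable_of_tendsto_ae atTop hm hae) ?_
    filter_upwards [hae] with q hq
    exact le_of_tendsto hq.norm (Eventually.of_forall (fun n => hbd n q))
  · exact tendsto_integral_of_dominated_convergence _ hm hb (fun n => Eventually.of_forall (hbd n)) hae

lemma Psi0_integral (f : ℂ → ℝ) (hf0 : ∀ x, 0 ≤ f x)
    {d : ℕ} (a : ℝ) (ha : 0 < a) (ha' : a ≤ 2 * π)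
    (T : Fin (d+1) → Fin (d+1) → Prop) (hTirr : ∀ i, ¬ T i i) (L : ℝ)
    (hi : Integrable (Psi0 f a L T) (QQ d)) :
    L^d * ∫ q, Psi0 f a L T q ∂(QQ d) = d.factorial * ∫ x, phiT a (d+1) T (L * f x) * f x := by
  rw [QQ] at hi ⊢
  rw [integral_prod _ hi, ← integral_const_mul, ← integral_const_mul]
  refine integral_congr_ae ?_
  filter_upwards [hi.prod_right_ae] with x hx
  rw [phiT_eq ha ha' d T hTirr]
  by_cases h0 : f x = 0
  · simp [Psi0, h0]
  · rw [integral_prod_symm _ hx, integral_pi_U0]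
    simp only [Psi0, integral_const_mul]
    have : (d.factorial : ℝ) ≠ 0 := by positivity
    field_simp
    ring

lemma EFH_tendsto (f : ℂ → ℝ) (hf : Measurable f) (hf0 : ∀ x, 0 ≤ f x) (C : ℝ) (hC : ∀ x, f x ≤ C) 
    (hfi : Integrable f) (hfc : ∀ᵐ x, ContinuousAt f x)
    {d : ℕ} (a : ℝ) (ha : 0 < a) (ha' : a ≤ 2 * π)
    (T : Fin (d+1) → Fin (d+1) → Prop) (hTirr : ∀ i, ¬ T i i) (hT : (SimpleGraph.fromRel T).Connected)
    [IsProbabilityMeasure (volume.withDensity fun x : ℂ => ENNReal.ofReal (f x))]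
    (r : ℕ → ℝ) (hrpos : ∀ n, 0 < r n) (L : ℝ)
    (hr : Tendsto (fun n : ℕ => (n : ℝ) * r n ^ 2) atTop (𝓝 L)) :
    Tendsto (fun n : ℕ => (∫ w, FH a (r n) T w ∂(Measure.pi fun _ : Fin n => 
      (volume.withDensity fun x : ℂ => ENNReal.ofReal (f x)).prod U0)) / n) atTop
      (𝓝 (d.factorial * ∫ x, phiT a (d+1) T (L * f x) * f x)) := by
  obtain ⟨h1, h2⟩ := Psi0_int f hf hf0 C hC hfi hfc a T hT r hrpos L hr
  rw [← Psi0_integral f hf0 a ha ha' T hTirr L h1]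
  have h3 := (descFac_tendsto (d+1)).mul ((hr.pow d).mul h2)
  rw [one_mul] at h3
  refine h3.congr' ?_
  filter_upwards [eventually_gt_atTop 0] with n hn
  have : (n:ℝ) ≠ 0 := by positivity
  rw [integral_FH, (Psi_main f hf hf0 a (r n) (hrpos n) T (n - (d+1))).2]
  field_simp
  ring

def mm (d : ℕ) : ℕ := 4 * (d + 2) * (d + 4)
def KK (d n : ℕ) : ℕ := mm d + ⌈(n : ℝ) ^ ((1 : ℝ) / (4 * (d + 2)))⌉₊

lemma KK_desc (d n : ℕ) : (n : ℝ) ^ (d + 4) ≤ ((KK d n).descFactorial (mm d) : ℝ) := by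
  have h1 := Nat.pow_sub_le_descFactorial (KK d n) (mm d)
  have h2 : (n : ℝ) ^ ((1 : ℝ) / (4 * (d + 2))) ≤ ((KK d n + 1 - mm d : ℕ) : ℝ) := by
    refine (Nat.le_ceil _).trans ?_
    exact Nat.cast_le.2 (by unfold KK; omega)
  calc (n : ℝ) ^ (d + 4) = ((n : ℝ) ^ ((1 : ℝ) / (4 * (d + 2))))^(mm d) := by
        rw [← Real.rpow_natCast, ← Real.rpow_natCast, ← Real.rpow_mul (by positivity)]
        congr 1
        unfold mm
        push_cast
        field_simp
    _ ≤ ((KK d n + 1 - mm d : ℕ) : ℝ)^(mm d) := pow_le_pow_left₀ (by positivity) h2 _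
    _ ≤ _ := by exact_mod_cast h1

lemma KK_pow (d n : ℕ) (hn : 1 ≤ n) : ((KK d n : ℝ) ^ (d + 2))^2 ≤ (((mm d : ℝ) + 2) ^ (d+2))^2 * √n := by
  have hn' : (1:ℝ) ≤ n := by exact_mod_cast hn
  set t := (n : ℝ) ^ ((1 : ℝ) / (4 * (d + 2))) with ht
  have h1 : 1 ≤ t := Real.one_le_rpow hn' (by positivity)
  have h2 : (KK d n : ℝ) ≤ (mm d + 2) * t := by
    unfold KK
    push_cast
    have := (Nat.ceil_lt_add_one (zero_le_one.trans h1)).le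
    have h3 : (0:ℝ) ≤ mm d := by positivity
    nlinarith
  have h3 : (t^(d+2))^2 = √n := by
    rw [← pow_mul, ht, ← Real.rpow_natCast, ← Real.rpow_mul (by positivity), Real.sqrt_eq_rpow]
    congr 1
    push_cast
    field_simp
    norm_num
  calc ((KK d n : ℝ) ^ (d + 2))^2 ≤ (((mm d + 2) * t) ^ (d + 2))^2 := by gcongr
    _ = _ := by rw [← h3, mul_pow, mul_pow]

def bad (d n : ℕ) (r : ℝ) : Set (Fin n → ℂ × ℝ) := {w | ∃ v, KK d n < Dcnt ((d+2) * r) w v}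

lemma meas_bad (d n : ℕ) (r : ℝ) : MeasurableSet (bad d n r) := by
  unfold bad
  rw [Set.ofPred_exists]
  exact MeasurableSet.iUnion (fun v => measurableSet_lt measurable_const (measurable_Dcnt _ v))

lemma bad_bound (μ : Measure (ℂ × ℝ)) [IsProbabilityMeasure μ] (C1 : ℝ) (hC1 : 0 ≤ C1)
    (hB : ∀ ρ : ℝ, 0 ≤ ρ → ∀ p : ℂ, μ {e | ‖e.1 - p‖ ≤ ρ} ≤ ENNReal.ofReal (C1 * ρ^2))
    (r : ℝ) (hr : 0 < r) (M : ℝ) (d n : ℕ) (hn : 1 ≤ n) (hM : (n:ℝ) * r^2 ≤ M) :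
    (n:ℝ)^(d+3) * (Measure.pi fun _ : Fin n => μ).real (bad d n r) ≤ (C1 * (d+2)^2 * M)^(mm d) := by
  have h := bad_prob μ ((d+2) * r) _ (hB ((d+2)*r) (by positivity)) (by positivity) (mm d) (KK d n) n
  have h' := ENNReal.toReal_mono (by finiteness) h
  rw [ENNReal.toReal_mul, ENNReal.toReal_mul, ENNReal.toReal_pow, ENNReal.toReal_pow, ENNReal.toReal_ofReal (by positivity)] at h'
  simp only [ENNReal.toReal_natCast] at h'
  change _ * (Measure.pi fun _ : Fin n => μ).real (bad d n r) ≤ _ at h'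
  have hn' : (0:ℝ) < n := by exact_mod_cast hn
  refine le_of_mul_le_mul_left ?_ hn'
  calc (n:ℝ) * ((n:ℝ)^(d+3) * (Measure.pi fun _ : Fin n => μ).real (bad d n r)) 
      = (n:ℝ)^(d+4) * (Measure.pi fun _ : Fin n => μ).real (bad d n r) := by ring
    _ ≤ ((KK d n).descFactorial (mm d) : ℝ) * (Measure.pi fun _ : Fin n => μ).real (bad d n r) := by
        gcongr
        exact KK_desc d n
    _ ≤ _ := h'
    _ = n * (C1 * (d+2)^2 * (n * r^2))^(mm d) := by
        rw [pow_succ' (n:ℝ), mul_assoc, ← mul_pow]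
        congr 2
        ring
    _ ≤ _ := by gcongr

def FT (a r : ℝ) {d n : ℕ} (T : Fin (d + 1) → Fin (d + 1) → Prop) (w : Fin n → ℂ × ℝ) : ℝ :=
  FK a r ((d+2) * r) (KK d n) T w

lemma FK_nonneg (a r ρ : ℝ) (K : ℕ) {d n : ℕ} (T : Fin (d + 1) → Fin (d + 1) → Prop) (w : Fin n → ℂ × ℝ) :
    0 ≤ FK a r ρ K T w := by unfold FK; positivity

lemma abs_FK_le (a r ρ : ℝ) (K : ℕ) {d n : ℕ} (T : Fin (d + 1) → Fin (d + 1) → Prop) (w : Fin n → ℂ × ℝ) :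
    |FK a r ρ K T w| ≤ (n:ℝ)^(d+1) := by
  rw [abs_of_nonneg (FK_nonneg ..)]
  exact (FK_le_FH ..).trans (FH_le ..)

def dev (μ : Measure (ℂ × ℝ)) (a r : ℝ) {d n : ℕ} (T : Fin (d + 1) → Fin (d + 1) → Prop) (ε : ℝ) : Set (Fin n → ℂ × ℝ) :=
  {w | ε * n ≤ |FT a r T w - ∫ w', FT a r T w' ∂(Measure.pi fun _ : Fin n => μ)|}

lemma meas_dev (μ : Measure (ℂ × ℝ)) (a r : ℝ) {d n : ℕ} (T : Fin (d + 1) → Fin (d + 1) → Prop) (ε : ℝ) :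
    MeasurableSet (dev (n := n) μ a r T ε) := by
  have : Measurable (fun w : Fin n → ℂ × ℝ => FT a r T w) := measurable_FK ..
  exact measurableSet_le measurable_const (by fun_prop)

lemma dev_bound (μ : Measure (ℂ × ℝ)) [IsProbabilityMeasure μ] (a : ℝ) (r : ℝ) (hr : 0 < r) {d : ℕ}
    (T : Fin (d + 1) → Fin (d + 1) → Prop) (hT : (SimpleGraph.fromRel T).Connected)
    (ε : ℝ) (hε : 0 < ε) (n : ℕ) (hn : 1 ≤ n) :
    (n:ℝ)^2 * (Measure.pi fun _ : Fin n => μ).real (dev μ a r T ε) ≤ 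
      48 * (2 * (50 * ((mm d : ℝ) + 2) ^ (d+2))^2 / ε^2)^4 := by
  have hn' : (0:ℝ) < n := by exact_mod_cast hn
  have h := mcd μ (50 * (KK d n : ℝ)^(d+2)) n (fun w => FT a r T w) (measurable_FK ..) ⟨_, abs_FK_le _ _ _ _ T⟩
    (fun w i e => FK_diff hr hT w i e) (ε * n) (by positivity)
  change (Measure.pi fun _ : Fin n => μ).real (dev μ a r T ε) ≤ _ at h
  set A := 2 * (50 * ((mm d : ℝ) + 2) ^ (d+2))^2 with hA
  have hA0 : 0 < A := by positivity
  have hK0 : 0 < (KK d n : ℝ) := by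
    have : 0 < KK d n := by unfold KK mm; positivity
    exact_mod_cast this
  have h1 : ε^2 / A * √n ≤ (ε * n)^2 / (2 * (n * (50 * (KK d n : ℝ)^(d+2))^2)) := by
    have hk := KK_pow d n hn
    have hs : √(n:ℝ) * √(n:ℝ) = n := Real.mul_self_sqrt hn'.le
    have hs0 : 0 < √(n:ℝ) := Real.sqrt_pos.2 hn'
    calc ε^2 / A * √n = (ε * n)^2 / (n * (A * √n)) := by
          field_simp
          rw [sq, hs]
      _ ≤ _ := by
          refine div_le_div_of_nonneg_left (by positivity) (by positivity) ?_
          rw [hA]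
          nlinarith
  set x := ε^2 / A * √n with hx
  have hx0 : 0 < x := by positivity
  have h2 := Real.pow_div_factorial_le_exp x hx0.le 4
  have h3 : Real.exp (- (ε * n)^2 / (2 * (n * (50 * (KK d n : ℝ)^(d+2))^2))) ≤ 24 / x^4 := by
    rw [neg_div]
    refine (Real.exp_le_exp.2 (neg_le_neg h1)).trans ?_
    rw [Real.exp_neg, inv_le_comm₀ (Real.exp_pos _) (by positivity)]
    refine le_trans (le_of_eq ?_) h2
    rw [inv_div]
    norm_num [Nat.factorial]
  have h4 : (n:ℝ)^2 * (2 * (24/x^4)) = 48 * (A/ε^2)^4 := by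
    have : x^4 = (ε^2/A)^4 * n^2 := by
      rw [hx, mul_pow, show (√(n:ℝ))^4 = (√(n:ℝ)^2)^2 by ring, Real.sq_sqrt hn'.le]
    rw [this]
    field_simp
    norm_num
  rw [← h4]
  gcongr
  exact h.trans (by gcongr)

lemma E_diff (μ : Measure (ℂ × ℝ)) [IsProbabilityMeasure μ] (a : ℝ) (r : ℝ) {d : ℕ}
    (T : Fin (d + 1) → Fin (d + 1) → Prop) (n : ℕ) :
    |∫ w, FH a r T w ∂(Measure.pi fun _ : Fin n => μ) - ∫ w, FT a r T w ∂(Measure.pi fun _ : Fin n => μ)| ≤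
      (n:ℝ)^(d+1) * (Measure.pi fun _ : Fin n => μ).real (bad d n r) := by
  have hFH0 : ∀ w : Fin n → ℂ × ℝ, 0 ≤ FH a r T w := fun w => by unfold FH; positivity
  have i1 : Integrable (fun w => FH a r T w) (Measure.pi fun _ : Fin n => μ) :=
    Integrable.of_bound (measurable_FH a r T).aestronglyMeasurable ((n:ℝ)^(d+1))
      (Eventually.of_forall (fun w => by rw [Real.norm_eq_abs, abs_of_nonneg (hFH0 w)]; exact FH_le ..))
  have i2 : Integrable (fun w => FT a r T w) (Measure.pi fun _ : Fin n => μ) :=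
    Integrable.of_bound (measurable_FK a r _ _ T).aestronglyMeasurable ((n:ℝ)^(d+1))
      (Eventually.of_forall (fun w => abs_FK_le ..))
  rw [← integral_sub i1 i2]
  refine (abs_integral_le_integral_abs).trans ?_
  calc _ ≤ ∫ w, (bad d n r).indicator (fun _ => (n:ℝ)^(d+1)) w ∂(Measure.pi fun _ : Fin n => μ) := by
        refine integral_mono (i1.sub i2).abs ((integrable_const _).indicator (meas_bad d n r)) (fun w => ?_)
        by_cases hw : w ∈ bad d n r
        · simp only [indicator_of_mem hw]
          rw [FT, abs_of_nonneg (sub_nonneg.2 (FK_le_FH ..))]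
          have := FH_le a r T w
          have := FK_nonneg a r ((d+2)*r) (KK d n) T w
          linarith
        · simp only [indicator_of_notMem hw]
          have : ∀ v, Dcnt ((d+2) * r) w v ≤ KK d n := by
            intro v
            by_contra hv
            exact hw ⟨v, not_le.1 hv⟩
          rw [FT, FK_eq_FH _ _ _ _ T w this]
          simp
    _ = _ := by
        rw [integral_indicator (meas_bad d n r), setIntegral_const, smul_eq_mul, mul_comm]

lemma law_pi {Ω : Type} [MeasureSpace Ω] [IsProbabilityMeasure (ℙ : Measure Ω)] (μ : Measure (ℂ × ℝ))
    (Z : ℕ → Ω → ℂ × ℝ) (hZm : ∀ i, Measurable (Z i))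
    (hZi : iIndepFun Z ℙ) (hZd : ∀ i, Measure.map (Z i) ℙ = μ) (n : ℕ) :
    Measure.map (fun ω (i : Fin n) => Z i ω) (ℙ : Measure Ω) = Measure.pi fun _ : Fin n => μ := by
  have h := (iIndepFun_iff_map_fun_eq_pi_map (f := fun i : Fin n => Z i) 
    (fun i => (hZm i).aemeasurable)).1 (hZi.precomp Fin.val_injective)
  rw [h]
  simp only [hZd]

lemma ball_mass (f : ℂ → ℝ) (C : ℝ) (hC0 : 0 ≤ C) (hC : ∀ x, f x ≤ C) (ρ : ℝ) (hρ : 0 ≤ ρ) (p : ℂ) :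
    ((volume.withDensity fun x : ℂ => ENNReal.ofReal (f x)).prod U0) {e | ‖e.1 - p‖ ≤ ρ} ≤
      ENNReal.ofReal (C * π * ρ^2) := by
  have h : {e : ℂ × ℝ | ‖e.1 - p‖ ≤ ρ} = Metric.closedBall p ρ ×ˢ (univ : Set ℝ) := by
    ext e; simp [dist_eq_norm]
  rw [h, Measure.prod_prod, measure_univ, mul_one, withDensity_apply _ measurableSet_closedBall]
  calc _ ≤ ∫⁻ x in Metric.closedBall p ρ, ENNReal.ofReal C := 
        lintegral_mono (fun x => ENNReal.ofReal_le_ofReal (hC x))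
    _ = ENNReal.ofReal (C * π * ρ^2) := by
        rw [lintegral_const, Measure.restrict_apply_univ, Complex.volume_closedBall, 
          ENNReal.ofReal_mul (by positivity), ENNReal.ofReal_mul hC0, ENNReal.ofReal_pow hρ, mul_assoc]
        congr 1
        rw [mul_comm]
        congr 1
        rw [← NNReal.coe_real_pi, ENNReal.ofReal_coe_nnreal]

lemma main_aux {Ω : Type} [MeasureSpace Ω] [IsProbabilityMeasure (ℙ : Measure Ω)]
    (f : ℂ → ℝ) (hf : Measurable f) (hf0 : ∀ x, 0 ≤ f x) (C : ℝ) (hC : ∀ x, f x ≤ C)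
    (hfc : ∀ᵐ x : ℂ, ContinuousAt f x)
    (a : ℝ) (ha : 0 < a) (ha' : a ≤ 2 * π)
    (Z : ℕ → Ω → ℂ × ℝ) (hZm : ∀ i, Measurable (Z i))
    (hZi : iIndepFun Z ℙ)
    (hZd : ∀ i, Measure.map (Z i) ℙ =
      (volume.withDensity fun x => ENNReal.ofReal (f x)).prod U0)
    (d : ℕ) (T : Fin (d+1) → Fin (d+1) → Prop) (hTirr : ∀ i, ¬ T i i)
    (hTconn : (SimpleGraph.fromRel T).Connected)
    (r : ℕ → ℝ) (hrpos : ∀ n, 0 < r n) (L : ℝ)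
    (hr : Tendsto (fun n : ℕ => (n : ℝ) * r n ^ 2) atTop (𝓝 L)) :
    ∀ᵐ ω ∂ℙ, Tendsto (fun n : ℕ =>
        (isolatedCount a (r n) T
          (fun i : Fin n => (Z i ω).1) (fun i : Fin n => (Z i ω).2) : ℝ) / n)
      atTop (𝓝 (((d+1 : ℕ) : ℝ)⁻¹ * ∫ x : ℂ, phiT a (d+1) T (L * f x) * f x)) := by
  set ν := volume.withDensity fun x : ℂ => ENNReal.ofReal (f x) with hν
  have hC0 : 0 ≤ C := (hf0 0).trans (hC 0)
  have hprod : IsProbabilityMeasure (ν.prod U0) := by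
    rw [← hZd 0]; exact Measure.isProbabilityMeasure_map (hZm 0).aemeasurable
  have hνp : IsProbabilityMeasure ν := by
    constructor
    have := hprod.measure_univ
    rwa [← univ_prod_univ, Measure.prod_prod, measure_univ (μ := U0), mul_one] at this
  have hfi : Integrable f := by
    refine ⟨hf.aestronglyMeasurable, ?_⟩
    rw [hasFiniteIntegral_iff_ofReal (Eventually.of_forall hf0)]
    have := hνp.measure_univ
    rw [hν, withDensity_apply _ MeasurableSet.univ, Measure.restrict_univ] at this
    rw [this]; exact ENNReal.one_lt_top
  have hE := EFH_tendsto f hf hf0 C hC hfi hfc a ha ha' T hTirr hTconn r hrpos L hr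
  rw [← hν] at hE
  obtain ⟨M, hM⟩ := hr.bddAbove_range
  have hM' : ∀ n : ℕ, (n:ℝ) * r n ^2 ≤ M := fun n => hM ⟨n, rfl⟩
  set μ := ν.prod U0 with hμ
  set P : (n : ℕ) → Measure (Fin n → ℂ × ℝ) := fun n => Measure.pi fun _ : Fin n => μ with hP
  set W : (n : ℕ) → Ω → (Fin n → ℂ × ℝ) := fun n ω i => Z i ω with hW
  have hWm : ∀ n, Measurable (W n) := fun n => measurable_pi_lambda _ (fun i => hZm i)
  have hlaw : ∀ n, Measure.map (W n) ℙ = P n := fun n => law_pi μ Z hZm hZi hZd n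
  set M1 : ℝ := (C * π * (d+2)^2 * M)^(mm d) with hM1
  have hbad : ∀ n : ℕ, 1 ≤ n → (n:ℝ)^(d+3) * (P n).real (bad d n (r n)) ≤ M1 := fun n hn =>
    bad_bound μ (C * π) (by positivity) (fun ρ hρ p => ball_mass f C hC0 hC ρ hρ p) (r n) (hrpos n) M d n hn (hM' n)
  have hsum2 : ∀ c : ℝ, Summable (fun n : ℕ => c * (1 / (n:ℝ)^2)) := fun c =>
    (Real.summable_one_div_nat_pow.2 (by norm_num)).mul_left c
  have BC : ∀ (A : (n : ℕ) → Set (Fin n → ℂ × ℝ)) (c : ℝ), (∀ n, MeasurableSet (A n)) →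
      (∀ n : ℕ, 1 ≤ n → (n:ℝ)^2 * (P n).real (A n) ≤ c) → ∀ᵐ ω ∂(ℙ : Measure Ω), ∀ᶠ n in atTop, W n ω ∉ A n := by
    intro A c hA hc
    have key : (∑' n, (ℙ : Measure Ω) (if n = 0 then ∅ else W n ⁻¹' A n)) ≠ ⊤ := by
      refine ne_top_of_le_ne_top (hsum2 c).tsum_ofReal_ne_top (ENNReal.tsum_le_tsum (fun n => ?_))
      by_cases hn : n = 0
      · simp [hn]
      · rw [if_neg hn, ← Measure.map_apply (hWm n) (hA n), hlaw n, ← ofReal_measureReal]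
        refine ENNReal.ofReal_le_ofReal ?_
        have := hc n (by omega)
        have hn' : (0:ℝ) < n := by exact_mod_cast (by omega)
        rw [mul_one_div, le_div_iff₀ (by positivity), mul_comm]
        exact this
    filter_upwards [ae_eventually_notMem key] with ω hω
    filter_upwards [hω, eventually_gt_atTop 0] with n h1 h2
    rw [if_neg (by omega)] at h1
    exact h1
  have hEd : Tendsto (fun n : ℕ => (∫ w, FT a (r n) T w ∂(P n)) / n) atTop
      (𝓝 (d.factorial * ∫ x, phiT a (d+1) T (L * f x) * f x)) := by
    have h0 : Tendsto (fun n : ℕ => (∫ w, FH a (r n) T w ∂(P n)) / n - (∫ w, FT a (r n) T w ∂(P n)) / n) atTop (𝓝 0) := by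
      have hz : Tendsto (fun n : ℕ => M1 * (1 / (n:ℝ)^2)) atTop (𝓝 0) := (hsum2 M1).tendsto_atTop_zero
      refine squeeze_zero_norm' ?_ hz
      filter_upwards [eventually_ge_atTop 1] with n hn
      have hn' : (1:ℝ) ≤ n := by exact_mod_cast hn
      have e1 := E_diff μ a (r n) T n
      have e2 := hbad n hn
      rw [← sub_div, Real.norm_eq_abs, abs_div, abs_of_pos (by linarith : (0:ℝ) < n), div_le_iff₀ (by linarith)]
      refine e1.trans ?_
      have e3 : (n:ℝ)^(d+1) * (P n).real (bad d n (r n)) ≤ M1 * (1/(n:ℝ)^2) := by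
        rw [mul_one_div, le_div_iff₀ (by positivity)]
        refine le_trans (le_of_eq ?_) e2
        ring
      have e4 : 0 ≤ M1 * (1/(n:ℝ)^2) := le_trans (by positivity) e3
      exact e3.trans (le_mul_of_one_le_right e4 hn')
    have := hE.sub h0
    rw [sub_zero] at this
    refine this.congr (fun n => ?_)
    exact sub_sub_cancel _ _
  have hb := BC (fun n => bad d n (r n)) M1 (fun n => meas_bad d n (r n)) (fun n hn => by
    refine le_trans ?_ (hbad n hn)
    have hn' : (1:ℝ) ≤ n := by exact_mod_cast hn
    gcongr
    omega)
  have hdv := fun j : ℕ => BC (fun n => dev μ a (r n) T (1/((j:ℝ)+1))) _ (fun n => meas_dev μ a (r n) T _) 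
    (fun n hn => dev_bound μ a (r n) (hrpos n) T hTconn (1/((j:ℝ)+1)) (by positivity) n hn)
  filter_upwards [hb, ae_all_iff.2 hdv] with ω h1 h2
  have h3 : Tendsto (fun n : ℕ => FT a (r n) T (W n ω) / n - (∫ w, FT a (r n) T w ∂(P n)) / n) atTop (𝓝 0) := by
    rw [Metric.tendsto_atTop']
    intro ε hε
    obtain ⟨j, hj⟩ := exists_nat_one_div_lt hε
    obtain ⟨N, hN⟩ := eventually_atTop.1 (h2 j)
    refine ⟨N, fun n hn => ?_⟩
    have h4 := hN n hn.le
    have hn' : (0:ℝ) < n := by exact_mod_cast (by omega)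
    have h5 : |FT a (r n) T (W n ω) - ∫ w, FT a (r n) T w ∂(P n)| < 1/((j:ℝ)+1) * n := by
      by_contra hcon
      exact h4 (not_lt.1 hcon)
    rw [dist_zero_right, ← sub_div, Real.norm_eq_abs, abs_div, abs_of_pos hn', div_lt_iff₀ hn']
    exact h5.trans (by gcongr)
  have h4 := (h3.add hEd).div_const ((d+1).factorial : ℝ)
  have hlim : (0 + d.factorial * ∫ x, phiT a (d+1) T (L * f x) * f x) / ((d+1).factorial : ℝ) = 
      ((d+1 : ℕ) : ℝ)⁻¹ * ∫ x : ℂ, phiT a (d+1) T (L * f x) * f x := by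
    rw [Nat.factorial_succ]
    push_cast
    have : (d.factorial : ℝ) ≠ 0 := by positivity
    field_simp
    ring
  rw [hlim] at h4
  refine h4.congr' ?_
  filter_upwards [h1] with n hn
  have h5 : FT a (r n) T (W n ω) = FH a (r n) T (W n ω) := by
    refine FK_eq_FH _ _ _ _ T _ (fun v => ?_)
    by_contra hv
    exact hn ⟨v, not_le.1 hv⟩
  have h6 := count_eq a (r n) T (W n ω)
  have h7 : (isolatedCount a (r n) T (fun i : Fin n => (Z i ω).1) (fun i : Fin n => (Z i ω).2) : ℝ) * ((d+1).factorial : ℝ) =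
      FH a (r n) T (W n ω) := by
    unfold FH
    exact_mod_cast h6
  rw [sub_add_cancel, h5, ← h7]
  have : ((d+1).factorial : ℝ) ≠ 0 := by positivity
  field_simp

/-- Theorem 1: strong law of large numbers for the number of isolated induced
`T`-subdigraphs of the random scaled sector digraph in the regime `n rₙ² → λ ∈ (0,∞)`. -/
theorem statement0
    {Ω : Type} [MeasureSpace Ω] [IsProbabilityMeasure (ℙ : Measure Ω)]
    -- the common density of the points, bounded and a.e. continuous
    (f : ℂ → ℝ) (hf0 : ∀ x, 0 ≤ f x) (hfb : ∃ C, ∀ x, f x ≤ C)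
    (hfc : ∀ᵐ x : ℂ, ContinuousAt f x)
    -- the central angle α ∈ (0, 2π]
    (a : ℝ) (ha : 0 < a) (ha' : a ≤ 2 * π)
    -- `Z i = (Xᵢ, Yᵢ)`: i.i.d., `Xᵢ` with density `f`, `Yᵢ` uniform on `[0, 2π)`,
    -- the `Xᵢ` independent of the `Yᵢ`
    (Z : ℕ → Ω → ℂ × ℝ) (hZm : ∀ i, Measurable (Z i))
    (hZi : iIndepFun Z ℙ)
    (hZd : ∀ i, Measure.map (Z i) ℙ =
      (volume.withDensity fun x => ENNReal.ofReal (f x)).prod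
        ((ENNReal.ofReal (2 * π))⁻¹ • volume.restrict (Set.Ico 0 (2 * π))))
    -- `T` a feasible connected digraph of order `k ≥ 1`
    (k : ℕ) (hk : 1 ≤ k) (T : Fin k → Fin k → Prop) (hTirr : ∀ i, ¬ T i i)
    (hTconn : (SimpleGraph.fromRel T).Connected)
    (hTfeas : ∃ ρ : ℝ, 0 < ρ ∧
      0 < ℙ {ω | isoT a ρ T (fun i : Fin k => (Z i ω).1) (fun i : Fin k => (Z i ω).2)})
    -- the cutoffs, with `n rₙ² → λ ∈ (0, ∞)`
    (r : ℕ → ℝ) (hrpos : ∀ n, 0 < r n) (L : ℝ) (hL : 0 < L)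
    (hr : Tendsto (fun n : ℕ => (n : ℝ) * r n ^ 2) atTop (𝓝 L)) :
    -- a.s., `n⁻¹ H̃_{n,T} → k⁻¹ ∫ φ_T(λ f(x)) f(x) dx`
    ∀ᵐ ω ∂ℙ, Tendsto (fun n : ℕ =>
        (isolatedCount a (r n) T
          (fun i : Fin n => (Z i ω).1) (fun i : Fin n => (Z i ω).2) : ℝ) / n)
      atTop (𝓝 ((k : ℝ)⁻¹ * ∫ x : ℂ, phiT a k T (L * f x) * f x)) := by
  obtain ⟨d, rfl⟩ : ∃ d, k = d + 1 := ⟨k - 1, by omega⟩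
  obtain ⟨f', hm, h0, ⟨C, hC⟩, hc, hae⟩ := exists_meas_version f hf0 hfb hfc
  have hw : (volume.withDensity fun x : ℂ => ENNReal.ofReal (f x)) =
      volume.withDensity fun x : ℂ => ENNReal.ofReal (f' x) := by
    refine withDensity_congr_ae ?_
    filter_upwards [hae] with x hx
    rw [hx]
  have hintg : ∫ x : ℂ, phiT a (d + 1) T (L * f x) * f x =
      ∫ x : ℂ, phiT a (d + 1) T (L * f' x) * f' x := by
    refine integral_congr_ae ?_
    filter_upwards [hae] with x hx
    rw [hx]
  rw [hintg]
  refine main_aux f' hm h0 C hC hc a ha ha' Z hZm hZi ?_ d T hTirr hTconn r hrpos L hr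
  intro i
  rw [hZd i, hw]
  rfl

end
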